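/- Define V_n(t) = ∑_{j=1}^{⌊nt⌋} (ΔB_{j,n})³. Then for any times 0 ≤ t₁ < … < t_d and 0 ≤ s₁ < … < s_m, the random vector (B(t₁), …, B(t_d), V_n(s₁), …, V_n(s_m)) converges in distribution, as n → ∞, to the law of (B(t₁), …, B(t_d), κW(s₁), …, κW(s_m)), where W is a standard Brownian motion independent of B. In particular, the signed cubic variation of B is κW. -/

import Mathlib

open MeasureTheory ProbabilityTheory Filter Topology

noncomputable section

/-- `B` is a fractional Brownian motion with Hurst parameter `1/6`: a centered Gaussian
process with continuous sample paths and covariance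
`E[B s * B t] = (t^(1/3) + s^(1/3) - |t - s|^(1/3)) / 2` for `s, t ≥ 0`. -/
def IsFBM16 {Ω : Type*} [MeasureSpace Ω] (B : ℝ → Ω → ℝ) : Prop :=
  (∀ t : ℝ, Measurable (B t)) ∧
  (∀ ω : Ω, Continuous fun t : ℝ => B t ω) ∧
  (∀ (m : ℕ) (t : Fin m → ℝ) (c : Fin m → ℝ), (∀ i, 0 ≤ t i) →
    ∃ v : NNReal,
      Measure.map (fun ω => ∑ i, c i * B (t i) ω) (volume : Measure Ω) = gaussianReal 0 v) ∧
  (∀ s t : ℝ, 0 ≤ s → 0 ≤ t →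
    ∫ ω, B s ω * B t ω =
      (t ^ ((1 : ℝ) / 3) + s ^ ((1 : ℝ) / 3) - |t - s| ^ ((1 : ℝ) / 3)) / 2)

/-- `W` is a standard Brownian motion: a centered Gaussian process with continuous sample
paths, `W 0 = 0`, and covariance `E[W s * W t] = min s t` for `s, t ≥ 0`. -/
def IsStdBM {Ω : Type*} [MeasureSpace Ω] (W : ℝ → Ω → ℝ) : Prop :=
  (∀ t : ℝ, Measurable (W t)) ∧
  (∀ ω : Ω, Continuous fun t : ℝ => W t ω) ∧
  (∀ ω : Ω, W 0 ω = 0) ∧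
  (∀ (m : ℕ) (t : Fin m → ℝ) (c : Fin m → ℝ), (∀ i, 0 ≤ t i) →
    ∃ v : NNReal,
      Measure.map (fun ω => ∑ i, c i * W (t i) ω) (volume : Measure Ω) = gaussianReal 0 v) ∧
  (∀ s t : ℝ, 0 ≤ s → 0 ≤ t → ∫ ω, W s ω * W t ω = min s t)

/-- The term of the series defining `κ²`. -/
def kappaTerm (r : ℤ) : ℝ :=
  (|(r : ℝ) + 1| ^ ((1 : ℝ) / 3) + |(r : ℝ) - 1| ^ ((1 : ℝ) / 3)
    - 2 * |(r : ℝ)| ^ ((1 : ℝ) / 3)) ^ 3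

/-- Stein's identity for the standard Gaussian measure. -/
lemma integral_id_smul_gaussianReal {E : Type*} [NormedAddCommGroup E] [NormedSpace ℝ E]
    {f f' : ℝ → E} (hf : ∀ x, HasDerivAt f (f' x) x)
    (h0 : Integrable f (gaussianReal 0 1))
    (h1 : Integrable (fun x => x • f x) (gaussianReal 0 1))
    (h2 : Integrable f' (gaussianReal 0 1)) :
    ∫ x, x • f x ∂(gaussianReal 0 1) = ∫ x, f' x ∂(gaussianReal 0 1) := by
  have key : ∀ g : ℝ → E, Integrable g (gaussianReal 0 1) →
      Integrable (fun x => gaussianPDFReal 0 1 x • g x) := by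
    intro g hg
    rw [gaussianReal_of_var_ne_zero _ one_ne_zero] at hg
    rw [integrable_withDensity_iff_integrable_smul' (measurable_gaussianPDF 0 1)
      (ae_of_all _ fun _ => gaussianPDF_lt_top)] at hg
    simpa [toReal_gaussianPDF] using hg
  have hd : ∀ x, HasDerivAt (gaussianPDFReal 0 1) (- x * gaussianPDFReal 0 1 x) x := by
    intro x
    have h : HasDerivAt (fun x : ℝ => -(x - 0) ^ 2 / (2 * (1 : NNReal))) (-x) x := by
      have h1 := ((((hasDerivAt_id' x).sub_const (0 : ℝ)).fun_pow 2).fun_neg).div_const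
        (2 * ((1 : NNReal) : ℝ))
      refine h1.congr_deriv ?_
      simp
      ring
    have h3 := (h.exp).const_mul (√(2 * Real.pi * (1 : NNReal)))⁻¹
    refine h3.congr_deriv ?_
    rw [gaussianPDFReal_def]
    ring
  have hz := integral_eq_zero_of_hasDerivAt_of_integrable
    (f := fun x => gaussianPDFReal 0 1 x • f x)
    (f' := fun x => gaussianPDFReal 0 1 x • f' x - gaussianPDFReal 0 1 x • (x • f x))
    (fun x => by
      have := (hd x).smul (hf x)
      refine this.congr_deriv ?_
      rw [smul_smul, sub_eq_add_neg, ← neg_smul]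
      congr 2; ring)
    ((key _ h2).sub (key _ h1)) (key _ h0)
  rw [integral_sub (key _ h2) (key _ h1), sub_eq_zero] at hz
  rw [integral_gaussianReal_eq_integral_smul one_ne_zero,
    integral_gaussianReal_eq_integral_smul one_ne_zero, hz]

/-- A centered coordinate of unit variance of a Gaussian vector is standard Gaussian. -/
lemma map_eval_eq_gaussianReal {κ : Type*} [Fintype κ] (μ : Measure (κ → ℝ)) [IsGaussian μ]
    {k : κ} (hc : ∫ y, y k ∂μ = 0) (hk : ∫ y, y k * y k ∂μ = 1) :
    μ.map (fun y : κ → ℝ => y k) = gaussianReal 0 1 := by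
  have hg : HasGaussianLaw (fun y : κ → ℝ => y k) μ :=
    (IsGaussian.hasGaussianLaw_id (μ := μ)).eval k
  rw [hg.map_eq_gaussianReal, hc, variance_eq_sub hg.memLp_two]
  have : ∫ y, ((fun y : κ → ℝ => y k) ^ 2) y ∂μ = 1 := by
    rw [← hk]; congr 1; ext y; simp [sq]
  rw [this, hc]; simp

/-- Gaussian integration by parts: for a centered Gaussian vector `y` whose coordinate `y k` has
unit variance, `E[y k • f y]` is the expectation of the derivative of `f` in the direction
`(E[y k * y j])_j`. -/
lemma integral_eval_smul_of_isGaussian {κ : Type*} [Fintype κ] {E : Type*}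
    [NormedAddCommGroup E] [NormedSpace ℝ E]
    (μ : Measure (κ → ℝ)) [IsGaussian μ] (hc : ∀ k, ∫ y, y k ∂μ = 0) (k : κ)
    (hk : ∫ y, y k * y k ∂μ = 1) {f Df : (κ → ℝ) → E}
    (hd : ∀ y, HasDerivAt (fun x : ℝ => f (y + x • fun j => ∫ z, z k * z j ∂μ)) (Df y) 0)
    (h0 : Integrable f μ) (h1 : Integrable (fun y => y k • f y) μ) (h2 : Integrable Df μ)
    (hf : Continuous f) (hDf : Continuous Df) :
    ∫ y, y k • f y ∂μ = ∫ y, Df y ∂μ := by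
  set c : κ → ℝ := fun j => ∫ z, z k * z j ∂μ with hcdef
  have hmem : ∀ j, MemLp (fun y : κ → ℝ => y j) 2 μ := fun j =>
    (IsGaussian.hasGaussianLaw_id (μ := μ)).eval j |>.memLp_two
  set R : (κ → ℝ) → (κ → ℝ) := fun y j => y j - y k * c j with hR
  have hRm : Measurable R := by fun_prop
  have hind : IndepFun (fun y : κ → ℝ => y k) R μ := by
    have hL : HasGaussianLaw (fun y : κ → ℝ => ((fun _ : Unit => y k), R y)) μ := by
      let L : (κ → ℝ) →L[ℝ] ((Unit → ℝ) × (κ → ℝ)) :=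
        ContinuousLinearMap.prod (ContinuousLinearMap.pi fun _ => ContinuousLinearMap.proj k)
          (ContinuousLinearMap.pi fun j => ContinuousLinearMap.proj j -
            (c j) • ContinuousLinearMap.proj k)
      have := (IsGaussian.hasGaussianLaw_id (μ := μ)).map L
      have e : (fun y : κ → ℝ => ((fun _ : Unit => y k), R y)) = fun y => L (id y) := by
        funext y
        refine Prod.ext ?_ ?_ <;> ext j <;> simp [L, hR, mul_comm]
      rw [e]
      exact this
    have := hL.indepFun_of_covariance_eval (X := fun _ y => y k) (Y := fun j y => R y j) (by
      intro _ j
      simp only [hR]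
      rw [covariance_fun_sub_right (hmem k) (hmem j) ((hmem k).mul_const _),
        covariance_mul_const_right, covariance_eq_sub (hmem k) (hmem j),
        covariance_eq_sub (hmem k) (hmem k)]
      simp only [Pi.mul_apply, hc, hk]
      simp [hcdef])
    exact this.comp (φ := fun f : Unit → ℝ => f ()) (ψ := id) (by fun_prop) measurable_id
  have hlawk := map_eval_eq_gaussianReal μ (hc k) hk
  have hprod := (indepFun_iff_map_prod_eq_prod_map_map
    (measurable_pi_apply k).aemeasurable hRm.aemeasurable).1 hind
  rw [hlawk] at hprod
  have hpm : Measurable fun y : κ → ℝ => (y k, R y) := by fun_prop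
  have hrec : ∀ y : κ → ℝ, R y + y k • c = y := by intro y; ext j; simp [hR]
  have hJ : Continuous fun p : ℝ × (κ → ℝ) => p.2 + p.1 • c := by fun_prop
  have hcomp : ∀ g : ℝ × (κ → ℝ) → E, Continuous g →
      Integrable (fun y => g (y k, R y)) μ →
      Integrable g ((gaussianReal 0 1).prod (μ.map R)) ∧
      ∫ y, g (y k, R y) ∂μ = ∫ r, ∫ x, g (x, r) ∂(gaussianReal 0 1) ∂(μ.map R) := by
    intro g hg hgi
    have : IsProbabilityMeasure (μ.map R) := Measure.isProbabilityMeasure_map hRm.aemeasurable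
    have hi : Integrable g ((gaussianReal 0 1).prod (μ.map R)) := by
      rw [← hprod, integrable_map_measure hg.aestronglyMeasurable hpm.aemeasurable]
      exact hgi
    refine ⟨hi, ?_⟩
    rw [← integral_prod_symm _ hi, ← hprod, integral_map hpm.aemeasurable hg.aestronglyMeasurable]
  have e1 := hcomp (fun p => f (p.2 + p.1 • c)) (hf.comp hJ) (by simpa [hrec] using h0)
  have e2 := hcomp (fun p => p.1 • f (p.2 + p.1 • c)) (continuous_fst.smul (hf.comp hJ))
    (by simpa [hrec] using h1)
  have e3 := hcomp (fun p => Df (p.2 + p.1 • c)) (hDf.comp hJ) (by simpa [hrec] using h2)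
  simp only [hrec] at e1 e2 e3
  rw [e2.2, e3.2]
  have : IsProbabilityMeasure (μ.map R) := Measure.isProbabilityMeasure_map hRm.aemeasurable
  refine integral_congr_ae ?_
  filter_upwards [e1.1.prod_left_ae, e2.1.prod_left_ae, e3.1.prod_left_ae] with r i1 i2 i3
  refine integral_id_smul_gaussianReal (fun x => ?_) i1 i2 i3
  have := hd (r + x • c)
  rw [hasDerivAt_iff_tendsto_slope_zero] at this ⊢
  refine this.congr fun t => ?_
  simp only [zero_add, zero_smul, add_zero]
  rw [add_assoc, ← add_smul]

/-- A continuous function of polynomial growth. -/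
def PolyGrowth {κ E : Type*} [Fintype κ] [NormedAddCommGroup E] (f : (κ → ℝ) → E) : Prop :=
  Continuous f ∧ ∃ (C : ℝ) (m : ℕ), ∀ y, ‖f y‖ ≤ C * (1 + ‖y‖) ^ m

namespace PolyGrowth

variable {κ E : Type*} [Fintype κ] [NormedAddCommGroup E]

lemma of_bounded {f : (κ → ℝ) → E} (hf : Continuous f) (C : ℝ) (h : ∀ y, ‖f y‖ ≤ C) :
    PolyGrowth f :=
  ⟨hf, C, 0, by simpa using h⟩

lemma const (c : E) : PolyGrowth (fun _ : κ → ℝ => c) :=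
  of_bounded continuous_const ‖c‖ fun _ => le_rfl

lemma eval (k : κ) : PolyGrowth (fun y : κ → ℝ => y k) :=
  ⟨continuous_apply k, 1, 1, fun y => by
    have := norm_le_pi_norm y k
    simp only [pow_one, one_mul]
    linarith⟩

lemma exists_nonneg_bound {f : (κ → ℝ) → E} (hf : PolyGrowth f) :
    ∃ (C : ℝ) (m : ℕ), 0 ≤ C ∧ ∀ y, ‖f y‖ ≤ C * (1 + ‖y‖) ^ m := by
  obtain ⟨-, C, m, h⟩ := hf
  exact ⟨|C|, m, abs_nonneg _, fun y => (h y).trans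
    (mul_le_mul_of_nonneg_right (le_abs_self C) (by positivity))⟩

lemma add {f g : (κ → ℝ) → E} (hf : PolyGrowth f) (hg : PolyGrowth g) :
    PolyGrowth (fun y => f y + g y) := by
  obtain ⟨C, m, hC, h⟩ := hf.exists_nonneg_bound
  obtain ⟨D, n, hD, h'⟩ := hg.exists_nonneg_bound
  refine ⟨hf.1.add hg.1, C + D, m + n, fun y => ?_⟩
  have h1 : (1 : ℝ) ≤ 1 + ‖y‖ := by linarith [norm_nonneg y]
  have e1 : (1 + ‖y‖) ^ m ≤ (1 + ‖y‖) ^ (m + n) := pow_le_pow_right₀ h1 (by omega)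
  have e2 : (1 + ‖y‖) ^ n ≤ (1 + ‖y‖) ^ (m + n) := pow_le_pow_right₀ h1 (by omega)
  calc ‖f y + g y‖ ≤ C * (1 + ‖y‖) ^ m + D * (1 + ‖y‖) ^ n :=
        (norm_add_le _ _).trans (add_le_add (h y) (h' y))
    _ ≤ C * (1 + ‖y‖) ^ (m + n) + D * (1 + ‖y‖) ^ (m + n) := by gcongr
    _ = _ := by ring

lemma neg {f : (κ → ℝ) → E} (hf : PolyGrowth f) : PolyGrowth (fun y => - f y) :=
  ⟨hf.1.neg, by simpa using hf.2⟩

lemma sub {f g : (κ → ℝ) → E} (hf : PolyGrowth f) (hg : PolyGrowth g) :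
    PolyGrowth (fun y => f y - g y) := by
  simpa [sub_eq_add_neg] using hf.add hg.neg

lemma sum {α : Type*} (s : Finset α) {f : α → (κ → ℝ) → E} (hf : ∀ a, PolyGrowth (f a)) :
    PolyGrowth (fun y => ∑ a ∈ s, f a y) := by
  classical
  induction s using Finset.induction_on with
  | empty => simpa using const (0 : E)
  | insert a s ha ih => simpa [Finset.sum_insert ha] using (hf a).add ih

lemma smul [NormedSpace ℝ E] {f : (κ → ℝ) → ℝ} {g : (κ → ℝ) → E} (hf : PolyGrowth f)
    (hg : PolyGrowth g) : PolyGrowth (fun y => f y • g y) := by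
  obtain ⟨C, m, hC, h⟩ := hf.exists_nonneg_bound
  obtain ⟨D, n, hD, h'⟩ := hg.exists_nonneg_bound
  refine ⟨hf.1.smul hg.1, C * D, m + n, fun y => ?_⟩
  rw [norm_smul]
  calc ‖f y‖ * ‖g y‖ ≤ (C * (1 + ‖y‖) ^ m) * (D * (1 + ‖y‖) ^ n) :=
        mul_le_mul (h y) (h' y) (norm_nonneg _) (by positivity)
    _ = _ := by ring

lemma mul {f g : (κ → ℝ) → ℝ} (hf : PolyGrowth f) (hg : PolyGrowth g) :
    PolyGrowth (fun y => f y * g y) := hf.smul hg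

lemma pow {f : (κ → ℝ) → ℝ} (hf : PolyGrowth f) (n : ℕ) : PolyGrowth (fun y => f y ^ n) := by
  induction n with
  | zero => simpa using const (1 : ℝ)
  | succ n ih => simpa [pow_succ] using ih.mul hf

lemma integrable {f : (κ → ℝ) → E} (hf : PolyGrowth f) (μ : Measure (κ → ℝ)) [IsGaussian μ] :
    Integrable f μ := by
  obtain ⟨hc, C, m, h⟩ := hf
  have h1 : MemLp (fun y : κ → ℝ => 1 + ‖y‖) m μ :=
    (memLp_const (1 : ℝ)).add (IsGaussian.memLp_id μ m (by simp)).norm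
  have h2 := (h1.integrable_norm_pow').const_mul C
  refine h2.mono' hc.aestronglyMeasurable (ae_of_all _ fun y => (h y).trans (le_of_eq ?_))
  rw [Real.norm_of_nonneg (by positivity)]

end PolyGrowth

/-- Gaussian integration by parts for functions of polynomial growth. -/
lemma PolyGrowth.integral_eval_smul {κ E : Type*} [Fintype κ] [NormedAddCommGroup E]
    [NormedSpace ℝ E] {μ : Measure (κ → ℝ)} [IsGaussian μ] (hc : ∀ k, ∫ y, y k ∂μ = 0) {k : κ}
    (hk : ∫ y, y k * y k ∂μ = 1) {f Df : (κ → ℝ) → E} (hf : PolyGrowth f) (hDf : PolyGrowth Df)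
    (hd : ∀ y, HasDerivAt (fun x : ℝ => f (y + x • fun j => ∫ z, z k * z j ∂μ)) (Df y) 0) :
    ∫ y, y k • f y ∂μ = ∫ y, Df y ∂μ :=
  integral_eval_smul_of_isGaussian μ hc k hk hd (hf.integrable μ)
    (((PolyGrowth.eval k).smul hf).integrable μ) (hDf.integrable μ) hf.1 hDf.1

lemma hasDerivAt_eval_line {κ : Type*} (y v : κ → ℝ) (j : κ) :
    HasDerivAt (fun x : ℝ => (y + x • v) j) (v j) 0 := by
  simpa using ((hasDerivAt_id (0 : ℝ)).mul_const (v j)).const_add (y j)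

lemma hasDerivAt_hermite_two_line {κ : Type*} (y v : κ → ℝ) (j : κ) :
    HasDerivAt (fun x : ℝ => (y + x • v) j ^ 2 - 1) (2 * y j * v j) 0 := by
  simpa using ((hasDerivAt_eval_line y v j).fun_pow 2).sub_const 1

section Hermite

variable {κ : Type*} [Fintype κ] {μ : Measure (κ → ℝ)} [IsGaussian μ]

lemma polyGrowth_hermite_two (k : κ) : PolyGrowth (fun y : κ → ℝ => y k ^ 2 - 1) :=
  ((PolyGrowth.eval k).pow 2).sub (PolyGrowth.const 1)

lemma integral_hermite_two {k : κ} (hk : ∫ y, y k * y k ∂μ = 1) :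
    ∫ y, (y k ^ 2 - 1) ∂μ = 0 := by
  rw [integral_sub (((PolyGrowth.eval k).pow 2).integrable μ) (integrable_const 1)]
  simp [sq, hk]

/-- If `q` is centered, `E[h₂(y k) h₂(y l) q]` can be rewritten with the derivative of `q`. -/
lemma integral_hermite_two_mul_mul (hc : ∀ k, ∫ y, y k ∂μ = 0) {k l : κ}
    (hk : ∫ y, y k * y k ∂μ = 1) {q Dq : (κ → ℝ) → ℝ} (hq : PolyGrowth q) (hDq : PolyGrowth Dq)
    (hd : ∀ y, HasDerivAt (fun x : ℝ => q (y + x • fun j => ∫ z, z k * z j ∂μ)) (Dq y) 0)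
    (h0 : ∫ y, q y ∂μ = 0) :
    ∫ y, (y k ^ 2 - 1) * (y l ^ 2 - 1) * q y ∂μ =
      ∫ y, (y k * (y l ^ 2 - 1) + 2 * (∫ z, z k * z l ∂μ) * y l) * Dq y ∂μ := by
  set r := ∫ z, z k * z l ∂μ with hr
  have pk := PolyGrowth.eval k
  have pl := PolyGrowth.eval l
  have pl2 := polyGrowth_hermite_two l
  have s1 := PolyGrowth.integral_eval_smul hc hk (f := fun y => y k * (y l ^ 2 - 1) * q y)
    (Df := fun y => ((y l ^ 2 - 1) * q y + 2 * r * (y k * y l * q y)) + y k * (y l ^ 2 - 1) * Dq y)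
    ((pk.mul pl2).mul hq)
    (((pl2.mul hq).add ((PolyGrowth.const (2 * r)).mul ((pk.mul pl).mul hq))).add
      ((pk.mul pl2).mul hDq))
    (fun y => by
      refine (((hasDerivAt_eval_line y _ k).fun_mul (hasDerivAt_hermite_two_line y _ l)).fun_mul
        (hd y)).congr_deriv ?_
      simp only [hk, ← hr, zero_smul, add_zero]
      ring)
  have s2 := PolyGrowth.integral_eval_smul hc hk (f := fun y => y l * q y)
    (Df := fun y => r * q y + y l * Dq y) (pl.mul hq)
    (((PolyGrowth.const r).mul hq).add (pl.mul hDq))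
    (fun y => by
      refine ((hasDerivAt_eval_line y _ l).fun_mul (hd y)).congr_deriv ?_
      simp only [← hr, zero_smul, add_zero])
  rw [integral_add (((PolyGrowth.const r).mul hq).integrable μ) ((pl.mul hDq).integrable μ),
    integral_const_mul, h0, mul_zero, zero_add] at s2
  have i1 := (pl2.mul hq).integrable μ
  have i2 := ((PolyGrowth.const (2 * r)).mul ((pk.mul pl).mul hq)).integrable μ
  have i12 := ((pl2.mul hq).add ((PolyGrowth.const (2 * r)).mul ((pk.mul pl).mul hq))).integrable μ
  have i3 := ((pk.mul pl2).mul hDq).integrable μ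
  rw [integral_add i12 i3, integral_add i1 i2, integral_const_mul] at s1
  simp only [smul_eq_mul] at s1 s2
  have e1 : ∫ y, (y k ^ 2 - 1) * (y l ^ 2 - 1) * q y ∂μ =
      ∫ y, y k * (y k * (y l ^ 2 - 1) * q y) ∂μ - ∫ y, (y l ^ 2 - 1) * q y ∂μ := by
    rw [← integral_sub ((pk.mul ((pk.mul pl2).mul hq)).integrable μ) i1]
    congr 1; ext y; ring
  have e2 : ∫ y, (y k * (y l ^ 2 - 1) + 2 * r * y l) * Dq y ∂μ =
      ∫ y, y k * (y l ^ 2 - 1) * Dq y ∂μ + 2 * r * ∫ y, y l * Dq y ∂μ := by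
    rw [← integral_const_mul (2 * r), ← integral_add i3 (((pl.mul hDq).integrable μ).const_mul _)]
    congr 1; ext y; ring
  have e3 : ∫ y, y k * y l * q y ∂μ = ∫ y, y l * Dq y ∂μ := by
    rw [← s2]; congr 1; ext y; ring
  rw [e1, e2, s1, e3]
  ring

lemma integral_hermite_two_mul_hermite_two (hc : ∀ k, ∫ y, y k ∂μ = 0) {k l : κ}
    (hk : ∫ y, y k * y k ∂μ = 1) (hl : ∫ y, y l * y l ∂μ = 1) :
    ∫ y, (y k ^ 2 - 1) * (y l ^ 2 - 1) ∂μ = 2 * (∫ z, z k * z l ∂μ) ^ 2 := by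
  set r := ∫ z, z k * z l ∂μ with hr
  have pk := PolyGrowth.eval k
  have pl := PolyGrowth.eval l
  have pl2 := polyGrowth_hermite_two l
  have s1 := PolyGrowth.integral_eval_smul hc hk (f := fun y => y k * (y l ^ 2 - 1))
    (Df := fun y => (y l ^ 2 - 1) + 2 * r * (y k * y l))
    (pk.mul pl2) (pl2.add ((PolyGrowth.const (2 * r)).mul (pk.mul pl)))
    (fun y => by
      refine ((hasDerivAt_eval_line y _ k).fun_mul
        (hasDerivAt_hermite_two_line y _ l)).congr_deriv ?_
      simp only [hk, ← hr, zero_smul, add_zero]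
      ring)
  rw [integral_add (pl2.integrable μ) (((PolyGrowth.const (2 * r)).mul (pk.mul pl)).integrable μ),
    integral_hermite_two hl, integral_const_mul, ← hr, zero_add] at s1
  simp only [smul_eq_mul] at s1
  have e1 : ∫ y, (y k ^ 2 - 1) * (y l ^ 2 - 1) ∂μ =
      ∫ y, y k * (y k * (y l ^ 2 - 1)) ∂μ - ∫ y, (y l ^ 2 - 1) ∂μ := by
    rw [← integral_sub ((pk.mul (pk.mul pl2)).integrable μ) (pl2.integrable μ)]
    congr 1; ext y; ring
  rw [e1, s1, integral_hermite_two hl]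
  ring

lemma integral_one_add_sq_pow {k : κ} (hc : ∫ y, y k ∂μ = 0) (hk : ∫ y, y k * y k ∂μ = 1) :
    ∫ y, (1 + y k ^ 2) ^ 4 ∂μ = ∫ x, (1 + x ^ 2) ^ 4 ∂(gaussianReal 0 1) := by
  rw [← map_eval_eq_gaussianReal μ hc hk, integral_map (measurable_pi_apply k).aemeasurable]
  exact (by fun_prop : Continuous fun x : ℝ => (1 + x ^ 2) ^ 4).aestronglyMeasurable

lemma abs_mul_sq_sub_one_le (a b : ℝ) : |a * (b ^ 2 - 1)| ≤ (1 + a ^ 2) * (1 + b ^ 2) := by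
  rw [abs_mul]
  refine mul_le_mul ?_ ?_ (abs_nonneg _) (by positivity)
  · rw [abs_le]; constructor <;> nlinarith [sq_nonneg (a - 1), sq_nonneg (a + 1)]
  · rw [abs_le]; constructor <;> nlinarith [sq_nonneg b]

lemma four_mul_le_pow_four (a b c d : ℝ) :
    a * b * c * d ≤ (a ^ 4 + b ^ 4 + c ^ 4 + d ^ 4) / 4 := by
  nlinarith [sq_nonneg (a * b - c * d), sq_nonneg (a ^ 2 - b ^ 2), sq_nonneg (c ^ 2 - d ^ 2)]

/-- Covariance bound for products of second Hermite polynomials. -/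
lemma abs_integral_hermite_mul_centered_le (hc : ∀ k, ∫ y, y k ∂μ = 0) {k l k' l' : κ}
    (hk : ∫ y, y k * y k ∂μ = 1) (hl : ∫ y, y l * y l ∂μ = 1)
    (hk' : ∫ y, y k' * y k' ∂μ = 1) (hl' : ∫ y, y l' * y l' ∂μ = 1)
    (hkl : |∫ y, y k * y l ∂μ| ≤ 1) :
    |∫ y, ((y k ^ 2 - 1) * (y l ^ 2 - 1) - 2 * (∫ y, y k * y l ∂μ) ^ 2) *
        ((y k' ^ 2 - 1) * (y l' ^ 2 - 1) - 2 * (∫ y, y k' * y l' ∂μ) ^ 2) ∂μ| ≤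
      6 * (∫ x, (1 + x ^ 2) ^ 4 ∂(gaussianReal 0 1)) *
        (|∫ y, y k * y k' ∂μ| + |∫ y, y k * y l' ∂μ|) := by
  set M := ∫ x, (1 + x ^ 2) ^ 4 ∂(gaussianReal 0 1) with hM
  set q : (κ → ℝ) → ℝ :=
    fun y => (y k' ^ 2 - 1) * (y l' ^ 2 - 1) - 2 * (∫ y, y k' * y l' ∂μ) ^ 2 with hq
  have p2 := fun k : κ => polyGrowth_hermite_two k
  have p1 := fun k : κ => PolyGrowth.eval k
  have hqP : PolyGrowth q := ((p2 k').mul (p2 l')).sub (PolyGrowth.const _)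
  set r1 := ∫ y, y k * y k' ∂μ with hr1
  set r2 := ∫ y, y k * y l' ∂μ with hr2
  set r := ∫ y, y k * y l ∂μ with hr
  set Dq : (κ → ℝ) → ℝ := fun y =>
    2 * r1 * (y k' * (y l' ^ 2 - 1)) + 2 * r2 * (y l' * (y k' ^ 2 - 1)) with hDq
  have hDqP : PolyGrowth Dq := ((PolyGrowth.const (2 * r1)).mul ((p1 k').mul (p2 l'))).add
    ((PolyGrowth.const (2 * r2)).mul ((p1 l').mul (p2 k')))
  have hq0 : ∫ y, q y ∂μ = 0 := by
    rw [hq, integral_sub (((p2 k').mul (p2 l')).integrable μ) (integrable_const _),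
      integral_hermite_two_mul_hermite_two hc hk' hl']
    simp
  have h1 := integral_hermite_two_mul_mul (l := l) hc hk hqP hDqP (fun y => by
    refine (((hasDerivAt_hermite_two_line y _ k').fun_mul
      (hasDerivAt_hermite_two_line y _ l')).sub_const _).congr_deriv ?_
    simp only [zero_smul, add_zero, hDq, ← hr1, ← hr2]
    ring) hq0
  have e1 : ∫ y, ((y k ^ 2 - 1) * (y l ^ 2 - 1) - 2 * r ^ 2) * q y ∂μ =
      ∫ y, (y k ^ 2 - 1) * (y l ^ 2 - 1) * q y ∂μ := by
    have : ∀ y, ((y k ^ 2 - 1) * (y l ^ 2 - 1) - 2 * r ^ 2) * q y =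
      (y k ^ 2 - 1) * (y l ^ 2 - 1) * q y - 2 * r ^ 2 * q y := fun y => by ring
    simp only [this]
    rw [integral_sub ((((p2 k).mul (p2 l)).mul hqP).integrable μ)
      (((PolyGrowth.const (2 * r ^ 2)).mul hqP).integrable μ), integral_const_mul, hq0]
    ring
  change |∫ y, ((y k ^ 2 - 1) * (y l ^ 2 - 1) - 2 * r ^ 2) * q y ∂μ| ≤ _
  rw [e1, h1]
  have pu : ∀ k : κ, PolyGrowth (fun y : κ → ℝ => (1 + y k ^ 2) ^ 4) := fun k =>
    ((PolyGrowth.const 1).add ((p1 k).pow 2)).pow 4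
  have hI : ∫ y, 6 * (|r1| + |r2|) * (((1 + y k ^ 2) ^ 4 + (1 + y l ^ 2) ^ 4 +
      (1 + y k' ^ 2) ^ 4 + (1 + y l' ^ 2) ^ 4) / 4) ∂μ = 6 * M * (|r1| + |r2|) := by
    rw [integral_const_mul, integral_div,
      integral_add ((((pu k).add (pu l)).add (pu k')).integrable μ) ((pu l').integrable μ),
      integral_add (((pu k).add (pu l)).integrable μ) ((pu k').integrable μ),
      integral_add ((pu k).integrable μ) ((pu l).integrable μ),
      integral_one_add_sq_pow (hc _) hk, integral_one_add_sq_pow (hc _) hl,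
      integral_one_add_sq_pow (hc _) hk', integral_one_add_sq_pow (hc _) hl', ← hM]
    ring
  rw [← hI, ← Real.norm_eq_abs]
  refine norm_integral_le_of_norm_le ?_ (ae_of_all _ fun y => ?_)
  · have := (((((pu k).add (pu l)).add (pu k')).add (pu l')).integrable μ).div_const 4
    exact this.const_mul _
  · rw [Real.norm_eq_abs, abs_mul]
    have b1 : |y k * (y l ^ 2 - 1) + 2 * r * y l| ≤ 3 * ((1 + y k ^ 2) * (1 + y l ^ 2)) := by
      have t1 := abs_mul_sq_sub_one_le (y k) (y l)
      have t2 : |2 * r * y l| ≤ 2 * ((1 + y k ^ 2) * (1 + y l ^ 2)) := by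
        rw [abs_mul, abs_mul, abs_two]
        have : |y l| ≤ 1 + y l ^ 2 := by
          rw [abs_le]; constructor <;> nlinarith [sq_nonneg (y l - 1), sq_nonneg (y l + 1)]
        have h3 : |r| * |y l| ≤ 1 * (1 + y l ^ 2) :=
          mul_le_mul hkl this (abs_nonneg _) zero_le_one
        nlinarith [sq_nonneg (y k), sq_nonneg (y l), mul_nonneg (sq_nonneg (y k)) (sq_nonneg (y l))]
      linarith [abs_add_le (y k * (y l ^ 2 - 1)) (2 * r * y l)]
    have b2 : |Dq y| ≤ 2 * (|r1| + |r2|) * ((1 + y k' ^ 2) * (1 + y l' ^ 2)) := by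
      have t1 := abs_mul_sq_sub_one_le (y k') (y l')
      have t2 := abs_mul_sq_sub_one_le (y l') (y k')
      have t3 := abs_add_le (2 * r1 * (y k' * (y l' ^ 2 - 1))) (2 * r2 * (y l' * (y k' ^ 2 - 1)))
      rw [abs_mul (2 * r1), abs_mul (2 * r2), abs_mul 2 r1, abs_mul 2 r2, abs_two] at t3
      have t4 := mul_le_mul_of_nonneg_left t1 (abs_nonneg r1)
      have t5 := mul_le_mul_of_nonneg_left t2 (abs_nonneg r2)
      calc |Dq y| ≤ _ := t3
        _ ≤ _ := by nlinarith
    have b3 := four_mul_le_pow_four (1 + y k ^ 2) (1 + y l ^ 2) (1 + y k' ^ 2) (1 + y l' ^ 2)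
    calc _ ≤ (3 * ((1 + y k ^ 2) * (1 + y l ^ 2))) *
          (2 * (|r1| + |r2|) * ((1 + y k' ^ 2) * (1 + y l' ^ 2))) :=
          mul_le_mul b1 b2 (abs_nonneg _) (by positivity)
      _ = 6 * (|r1| + |r2|) *
          ((1 + y k ^ 2) * (1 + y l ^ 2) * (1 + y k' ^ 2) * (1 + y l' ^ 2)) := by ring
      _ ≤ _ := mul_le_mul_of_nonneg_left b3 (by positivity)

end Hermite

lemma sum_row_products_le {ι : Type*} [Fintype ι] {r : ι → ι → ℝ} {S : ℝ} (h0 : ∀ k l, 0 ≤ r k l)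
    (hsymm : ∀ k l, r k l = r l k) (hS : ∀ k, ∑ l, r k l ≤ S) (hS0 : 0 ≤ S) :
    ∑ p : ι × ι, ∑ p' : ι × ι, r p.1 p.2 * r p'.1 p'.2 * (r p.1 p'.1 + r p.1 p'.2) ≤
      2 * Fintype.card ι * S ^ 3 := by
  have hS2 : ∀ k, ∑ l, r l k ≤ S := fun k => by simpa only [hsymm _ k] using hS k
  have key1 : ∀ k, ∑ p' : ι × ι, r p'.1 p'.2 * r k p'.1 ≤ S ^ 2 := by
    intro k
    rw [Fintype.sum_prod_type]
    calc ∑ k', ∑ l', r k' l' * r k k' = ∑ k', r k k' * ∑ l', r k' l' := by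
          refine Finset.sum_congr rfl fun k' _ => ?_
          rw [Finset.mul_sum]; exact Finset.sum_congr rfl fun _ _ => mul_comm _ _
      _ ≤ ∑ k', r k k' * S := Finset.sum_le_sum fun k' _ =>
          mul_le_mul_of_nonneg_left (hS k') (h0 _ _)
      _ = (∑ k', r k k') * S := by rw [Finset.sum_mul]
      _ ≤ S * S := mul_le_mul_of_nonneg_right (hS k) hS0
      _ = S ^ 2 := by ring
  have key2 : ∀ k, ∑ p' : ι × ι, r p'.1 p'.2 * r k p'.2 ≤ S ^ 2 := by
    intro k
    rw [Fintype.sum_prod_type_right]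
    calc ∑ l', ∑ k', r k' l' * r k l' = ∑ l', r k l' * ∑ k', r k' l' := by
          refine Finset.sum_congr rfl fun k' _ => ?_
          rw [Finset.mul_sum]; exact Finset.sum_congr rfl fun _ _ => mul_comm _ _
      _ ≤ ∑ l', r k l' * S := Finset.sum_le_sum fun k' _ =>
          mul_le_mul_of_nonneg_left (hS2 k') (h0 _ _)
      _ = (∑ k', r k k') * S := by rw [Finset.sum_mul]
      _ ≤ S * S := mul_le_mul_of_nonneg_right (hS k) hS0
      _ = S ^ 2 := by ring
  calc ∑ p : ι × ι, ∑ p' : ι × ι, r p.1 p.2 * r p'.1 p'.2 * (r p.1 p'.1 + r p.1 p'.2)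
      = ∑ p : ι × ι, r p.1 p.2 * (∑ p' : ι × ι, r p'.1 p'.2 * r p.1 p'.1 +
          ∑ p' : ι × ι, r p'.1 p'.2 * r p.1 p'.2) := by
        refine Finset.sum_congr rfl fun p _ => ?_
        rw [← Finset.sum_add_distrib, Finset.mul_sum]
        exact Finset.sum_congr rfl fun _ _ => by ring
    _ ≤ ∑ p : ι × ι, r p.1 p.2 * (S ^ 2 + S ^ 2) := Finset.sum_le_sum fun p _ =>
        mul_le_mul_of_nonneg_left (add_le_add (key1 _) (key2 _)) (h0 _ _)
    _ = ∑ k, (∑ l, r k l) * (S ^ 2 + S ^ 2) := by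
        rw [Fintype.sum_prod_type]
        exact Finset.sum_congr rfl fun _ _ => by rw [Finset.sum_mul]
    _ ≤ ∑ _k : ι, S * (S ^ 2 + S ^ 2) := Finset.sum_le_sum fun k _ =>
        mul_le_mul_of_nonneg_right (hS k) (by positivity)
    _ = _ := by
        rw [Finset.sum_const, nsmul_eq_mul, Finset.card_univ]; ring

lemma integral_abs_le_sqrt {α : Type*} [MeasurableSpace α] (μ : Measure α)
    [IsProbabilityMeasure μ] {f : α → ℝ} (hf : Integrable f μ)
    (hf2 : Integrable (fun x => f x ^ 2) μ) {C : ℝ} (h : ∫ x, f x ^ 2 ∂μ ≤ C) :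
    ∫ x, |f x| ∂μ ≤ √C := by
  refine Real.le_sqrt_of_sq_le (le_trans ?_ h)
  have h2 : 0 ≤ ∫ x, (|f x| - ∫ z, |f z| ∂μ) ^ 2 ∂μ := integral_nonneg fun x => sq_nonneg _
  have e : ∀ x, (|f x| - ∫ z, |f z| ∂μ) ^ 2 =
      f x ^ 2 - (2 * (∫ z, |f z| ∂μ) * |f x| - (∫ z, |f z| ∂μ) ^ 2) := fun x => by
    rw [← sq_abs (f x)]; ring
  simp only [e] at h2
  have i1 : Integrable (fun x => 2 * (∫ z, |f z| ∂μ) * |f x|) μ := hf.abs.const_mul _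
  have i2 : Integrable (fun x => 2 * (∫ z, |f z| ∂μ) * |f x| - (∫ z, |f z| ∂μ) ^ 2) μ :=
    i1.sub (integrable_const _)
  rw [integral_sub hf2 i2, integral_sub i1 (integrable_const _), integral_const_mul] at h2
  simp at h2
  nlinarith

section Chaos

variable {κ ι : Type*} [Fintype κ] [Fintype ι] {μ : Measure (κ → ℝ)} [IsGaussian μ]

lemma integral_abs_first_term_le (hc : ∀ k, ∫ y, y k ∂μ = 0) (e : ι → κ) (o : κ)
    (hk : ∀ k, ∫ y, y (e k) * y (e k) ∂μ = 1) (a : ι → ℝ) {α γ S : ℝ}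
    (ha : ∀ k, |a k| ≤ α) (hγ : ∀ k, |∫ y, y (e k) * y o ∂μ| ≤ γ)
    (hρ1 : ∀ k l, |∫ y, y (e k) * y (e l) ∂μ| ≤ 1)
    (hS : ∀ k, ∑ l, |∫ y, y (e k) * y (e l) ∂μ| ≤ S) :
    ∫ y, |∑ k, a k * (∫ y, y (e k) * y o ∂μ) * (y (e k) ^ 2 - 1)| ∂μ ≤
      √(2 * (α * γ) ^ 2 * Fintype.card ι * S) := by
  set c : ι → ℝ := fun k => ∫ y, y (e k) * y o ∂μ with hcdef
  have p2 := fun k : ι => polyGrowth_hermite_two (e k)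
  have pT : PolyGrowth (fun y : κ → ℝ => ∑ k, a k * c k * (y (e k) ^ 2 - 1)) :=
    PolyGrowth.sum _ fun k => (PolyGrowth.const (a k * c k)).mul (p2 k)
  refine integral_abs_le_sqrt μ (pT.integrable μ) ((pT.pow 2).integrable μ) ?_
  have ex : ∀ y : κ → ℝ, (∑ k, a k * c k * (y (e k) ^ 2 - 1)) ^ 2 =
      ∑ k, ∑ l, a k * c k * (a l * c l) * ((y (e k) ^ 2 - 1) * (y (e l) ^ 2 - 1)) := fun y => by
    rw [sq, Finset.sum_mul_sum]
    exact Finset.sum_congr rfl fun _ _ => Finset.sum_congr rfl fun _ _ => by ring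
  have ac : ∀ k, |a k * c k| ≤ α * γ := fun k => by
    rw [abs_mul]
    exact mul_le_mul (ha k) (hγ k) (abs_nonneg _) ((abs_nonneg _).trans (ha k))
  calc ∫ y, (∑ k, a k * c k * (y (e k) ^ 2 - 1)) ^ 2 ∂μ
      = ∑ k, ∑ l, a k * c k * (a l * c l) * (2 * (∫ y, y (e k) * y (e l) ∂μ) ^ 2) := by
        simp only [ex]
        rw [integral_finsetSum _ fun k _ => ((PolyGrowth.sum _ fun l =>
          (PolyGrowth.const (a k * c k * (a l * c l))).mul ((p2 k).mul (p2 l))).integrable μ)]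
        refine Finset.sum_congr rfl fun k _ => ?_
        rw [integral_finsetSum _ fun l _ =>
          (((PolyGrowth.const (a k * c k * (a l * c l))).mul ((p2 k).mul (p2 l))).integrable μ)]
        refine Finset.sum_congr rfl fun l _ => ?_
        rw [integral_const_mul, integral_hermite_two_mul_hermite_two hc (hk k) (hk l)]
    _ ≤ ∑ k, ∑ l, 2 * (α * γ) ^ 2 * |∫ y, y (e k) * y (e l) ∂μ| := by
        refine Finset.sum_le_sum fun k _ => Finset.sum_le_sum fun l _ => ?_
        have h1 : a k * c k * (a l * c l) ≤ (α * γ) ^ 2 := by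
          refine (le_abs_self _).trans ?_
          rw [abs_mul, sq]
          exact mul_le_mul (ac k) (ac l) (abs_nonneg _) ((abs_nonneg _).trans (ac k))
        have h2 : (∫ y, y (e k) * y (e l) ∂μ) ^ 2 ≤ |∫ y, y (e k) * y (e l) ∂μ| := by
          rw [← sq_abs, sq]
          exact mul_le_of_le_one_left (abs_nonneg _) (hρ1 k l)
        calc _ ≤ (α * γ) ^ 2 * (2 * (∫ y, y (e k) * y (e l) ∂μ) ^ 2) :=
              mul_le_mul_of_nonneg_right h1 (by positivity)
          _ ≤ (α * γ) ^ 2 * (2 * |∫ y, y (e k) * y (e l) ∂μ|) := by gcongr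
          _ = _ := by ring
    _ = ∑ k, 2 * (α * γ) ^ 2 * ∑ l, |∫ y, y (e k) * y (e l) ∂μ| := by
        simp only [Finset.mul_sum]
    _ ≤ ∑ _k : ι, 2 * (α * γ) ^ 2 * S := Finset.sum_le_sum fun k _ =>
        mul_le_mul_of_nonneg_left (hS k) (by positivity)
    _ = _ := by rw [Finset.sum_const, nsmul_eq_mul, Finset.card_univ]; ring

lemma integral_abs_second_term_le (hc : ∀ k, ∫ y, y k ∂μ = 0) (e : ι → κ)
    (hk : ∀ k, ∫ y, y (e k) * y (e k) ∂μ = 1) (a : ι → ℝ) {α S : ℝ}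
    (ha : ∀ k, |a k| ≤ α) (hS0 : 0 ≤ S)
    (hρ1 : ∀ k l, |∫ y, y (e k) * y (e l) ∂μ| ≤ 1)
    (hS : ∀ k, ∑ l, |∫ y, y (e k) * y (e l) ∂μ| ≤ S) :
    ∫ y, |3 * ∑ k, ∑ l, a k * a l * (∫ y, y (e k) * y (e l) ∂μ) *
        ((y (e k) ^ 2 - 1) * (y (e l) ^ 2 - 1)) -
        6 * ∑ k, ∑ l, a k * a l * (∫ y, y (e k) * y (e l) ∂μ) ^ 3| ∂μ ≤
      √(108 * (∫ x, (1 + x ^ 2) ^ 4 ∂(gaussianReal 0 1)) * α ^ 4 * Fintype.card ι * S ^ 3) := by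
  set M := ∫ x, (1 + x ^ 2) ^ 4 ∂(gaussianReal 0 1) with hM
  have hM0 : 0 ≤ M := integral_nonneg fun x => by positivity
  set r : ι → ι → ℝ := fun k l => ∫ y, y (e k) * y (e l) ∂μ with hr
  have hsymm : ∀ k l, r k l = r l k := fun k l => by simp only [hr, mul_comm]
  have p2 := fun k : ι => polyGrowth_hermite_two (e k)
  set q : ι × ι → (κ → ℝ) → ℝ := fun p y =>
    (y (e p.1) ^ 2 - 1) * (y (e p.2) ^ 2 - 1) - 2 * (r p.1 p.2) ^ 2 with hq
  have pq : ∀ p, PolyGrowth (q p) := fun p => ((p2 p.1).mul (p2 p.2)).sub (PolyGrowth.const _)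
  set w : ι × ι → ℝ := fun p => a p.1 * a p.2 * r p.1 p.2 with hw
  have ex : ∀ y : κ → ℝ, 3 * ∑ k, ∑ l, a k * a l * r k l *
        ((y (e k) ^ 2 - 1) * (y (e l) ^ 2 - 1)) - 6 * ∑ k, ∑ l, a k * a l * r k l ^ 3 =
      3 * ∑ p, w p * q p y := fun y => by
    rw [Fintype.sum_prod_type]
    have : (6 : ℝ) * ∑ k, ∑ l, a k * a l * r k l ^ 3 =
        3 * (2 * ∑ k, ∑ l, a k * a l * r k l ^ 3) := by ring
    rw [this, ← mul_sub]
    simp only [Finset.mul_sum, ← Finset.sum_sub_distrib]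
    refine Finset.sum_congr rfl fun _ _ => Finset.sum_congr rfl fun _ _ => ?_
    simp only [hw, hq]; ring
  change ∫ y : κ → ℝ, |3 * ∑ k, ∑ l, a k * a l * r k l *
        ((y (e k) ^ 2 - 1) * (y (e l) ^ 2 - 1)) - 6 * ∑ k, ∑ l, a k * a l * r k l ^ 3| ∂μ ≤ _
  simp only [ex]
  have pT : PolyGrowth (fun y : κ → ℝ => 3 * ∑ p, w p * q p y) :=
    (PolyGrowth.const 3).mul (PolyGrowth.sum _ fun p => (PolyGrowth.const (w p)).mul (pq p))
  refine integral_abs_le_sqrt μ (pT.integrable μ) ((pT.pow 2).integrable μ) ?_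
  have ex2 : ∀ y : κ → ℝ, (3 * ∑ p, w p * q p y) ^ 2 =
      ∑ p, ∑ p', 9 * (w p * w p') * (q p y * q p' y) := fun y => by
    rw [mul_pow, sq (∑ p, w p * q p y), Finset.sum_mul_sum, Finset.mul_sum]
    refine Finset.sum_congr rfl fun _ _ => ?_
    rw [Finset.mul_sum]
    exact Finset.sum_congr rfl fun _ _ => by ring
  have hwb : ∀ p, |w p| ≤ α ^ 2 * |r p.1 p.2| := fun p => by
    simp only [hw, abs_mul]
    refine mul_le_mul_of_nonneg_right ?_ (abs_nonneg _)
    rw [sq]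
    exact mul_le_mul (ha _) (ha _) (abs_nonneg _) ((abs_nonneg _).trans (ha p.1))
  calc ∫ y, (3 * ∑ p, w p * q p y) ^ 2 ∂μ
      = ∑ p, ∑ p', 9 * (w p * w p') * ∫ y, q p y * q p' y ∂μ := by
        simp only [ex2]
        rw [integral_finsetSum _ fun p _ => ((PolyGrowth.sum _ fun p' =>
          (PolyGrowth.const (9 * (w p * w p'))).mul ((pq p).mul (pq p'))).integrable μ)]
        refine Finset.sum_congr rfl fun p _ => ?_
        rw [integral_finsetSum _ fun p' _ =>
          (((PolyGrowth.const (9 * (w p * w p'))).mul ((pq p).mul (pq p'))).integrable μ)]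
        refine Finset.sum_congr rfl fun p' _ => ?_
        rw [integral_const_mul]
    _ ≤ ∑ p : ι × ι, ∑ p' : ι × ι, 54 * M * α ^ 4 * (|r p.1 p.2| * |r p'.1 p'.2| *
          (|r p.1 p'.1| + |r p.1 p'.2|)) := by
        refine Finset.sum_le_sum fun p _ => Finset.sum_le_sum fun p' _ => ?_
        refine (le_abs_self _).trans ?_
        rw [abs_mul, abs_mul, abs_mul (w p)]
        have hcov := abs_integral_hermite_mul_centered_le hc (hk p.1) (hk p.2) (hk p'.1) (hk p'.2)
          (hρ1 p.1 p.2)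
        rw [← hM] at hcov
        rw [abs_of_pos (by norm_num : (0 : ℝ) < 9)]
        calc 9 * (|w p| * |w p'|) * |∫ y, q p y * q p' y ∂μ|
            ≤ 9 * ((α ^ 2 * |r p.1 p.2|) * (α ^ 2 * |r p'.1 p'.2|)) *
              (6 * M * (|r p.1 p'.1| + |r p.1 p'.2|)) := by
              gcongr
              · exact hwb p
              · exact hwb p'
          _ = _ := by ring
    _ = 54 * M * α ^ 4 * ∑ p : ι × ι, ∑ p' : ι × ι, |r p.1 p.2| * |r p'.1 p'.2| *
          (|r p.1 p'.1| + |r p.1 p'.2|) := by simp only [Finset.mul_sum]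
    _ ≤ 54 * M * α ^ 4 * (2 * Fintype.card ι * S ^ 3) := by
        refine mul_le_mul_of_nonneg_left ?_ (by positivity)
        exact sum_row_products_le (r := fun k l => |r k l|) (fun _ _ => abs_nonneg _)
          (fun k l => by rw [hsymm]) hS hS0
    _ = _ := by ring

lemma PolyGrowth.cexp_mul_I {g : (κ → ℝ) → ℝ} (hg : Continuous g) (z : ℂ) :
    PolyGrowth (fun y => z * Complex.exp (g y * Complex.I)) :=
  PolyGrowth.of_bounded (by fun_prop) ‖z‖ fun y => by simp [Complex.norm_exp_ofReal_mul_I]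

lemma integral_hermite_three_smul_cexp (hc : ∀ k, ∫ y, y k ∂μ = 0) {k : κ}
    (hk : ∫ y, y k * y k ∂μ = 1) {g Dg : (κ → ℝ) → ℝ} (hg : Continuous g) (hDg : PolyGrowth Dg)
    (hd : ∀ y, HasDerivAt (fun x : ℝ => g (y + x • fun j => ∫ z, z k * z j ∂μ)) (Dg y) 0) :
    ∫ y, (y k ^ 3 - 3 * y k) • Complex.exp (g y * Complex.I) ∂μ =
      ∫ y, ((y k ^ 2 - 1) * Dg y) • (Complex.I * Complex.exp (g y * Complex.I)) ∂μ := by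
  have pk := PolyGrowth.eval k
  have p2 := polyGrowth_hermite_two k
  have pE := PolyGrowth.cexp_mul_I hg 1
  have pE' := PolyGrowth.cexp_mul_I hg Complex.I
  simp only [one_mul] at pE
  have q1 : PolyGrowth fun y : κ → ℝ => (2 * y k) • Complex.exp (g y * Complex.I) :=
    ((PolyGrowth.const 2).mul pk).smul pE
  have q2 : PolyGrowth fun y : κ → ℝ =>
      ((y k ^ 2 - 1) * Dg y) • (Complex.I * Complex.exp (g y * Complex.I)) :=
    (p2.mul hDg).smul pE'
  have s1 := PolyGrowth.integral_eval_smul hc hk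
    (f := fun y => (y k ^ 2 - 1) • Complex.exp (g y * Complex.I))
    (Df := fun y => (2 * y k) • Complex.exp (g y * Complex.I) +
      ((y k ^ 2 - 1) * Dg y) • (Complex.I * Complex.exp (g y * Complex.I)))
    (p2.smul pE) (q1.add q2) (fun y => by
      have h1 := ((hd y).ofReal_comp.mul_const Complex.I).cexp
      refine ((hasDerivAt_hermite_two_line y _ k).fun_smul h1).congr_deriv ?_
      simp only [hk, zero_smul, add_zero, Complex.real_smul]
      push_cast
      ring)
  rw [integral_add (q1.integrable μ) (q2.integrable μ)] at s1
  rw [← sub_eq_iff_eq_add'] at s1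
  rw [← s1, ← integral_sub ((pk.smul (p2.smul pE)).integrable μ) (q1.integrable μ)]
  congr 1; ext y
  rw [smul_smul, ← sub_smul]
  congr 1; ring

/-- Quantitative central limit theorem for sums of third Hermite polynomials of a Gaussian vector,
jointly with a further coordinate `o` of that vector. -/
lemma norm_integral_cexp_sub_le (hc : ∀ k, ∫ y, y k ∂μ = 0) (e : ι → κ) (o : κ)
    (hk : ∀ k, ∫ y, y (e k) * y (e k) ∂μ = 1) (a : ι → ℝ) {σ2 A Q : ℝ}
    (hA : ∫ y, |∑ k, a k * (∫ y, y (e k) * y o ∂μ) * (y (e k) ^ 2 - 1)| ∂μ ≤ A)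
    (hQ : ∫ y, |3 * ∑ k, ∑ l, a k * a l * (∫ y, y (e k) * y (e l) ∂μ) *
        ((y (e k) ^ 2 - 1) * (y (e l) ^ 2 - 1)) - σ2| ∂μ ≤ Q) :
    ‖∫ y, Complex.exp ((y o + ∑ k, a k * (y (e k) ^ 3 - 3 * y (e k)) : ℝ) * Complex.I) ∂μ -
      Complex.exp (-(σ2 : ℂ) / 2) * ∫ y, Complex.exp ((y o : ℝ) * Complex.I) ∂μ‖ ≤
      Real.exp |σ2| * (A + Q) := by
  set r : ι → ι → ℝ := fun k l => ∫ y, y (e k) * y (e l) ∂μ with hr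
  set c : ι → ℝ := fun k => ∫ y, y (e k) * y o ∂μ with hcdef
  set F : (κ → ℝ) → ℝ := fun y => ∑ k, a k * (y (e k) ^ 3 - 3 * y (e k)) with hF
  set T1 : (κ → ℝ) → ℝ := fun y => ∑ k, a k * c k * (y (e k) ^ 2 - 1) with hT1
  set T2 : (κ → ℝ) → ℝ := fun y => 3 * ∑ k, ∑ l, a k * a l * r k l *
        ((y (e k) ^ 2 - 1) * (y (e l) ^ 2 - 1)) with hT2
  have p1 := fun k : ι => PolyGrowth.eval (e k)
  have p2 := fun k : ι => polyGrowth_hermite_two (e k)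
  have pF : PolyGrowth F := PolyGrowth.sum _ fun k => (PolyGrowth.const (a k)).mul
    (((p1 k).pow 3).sub ((PolyGrowth.const 3).mul (p1 k)))
  have pT1 : PolyGrowth T1 := PolyGrowth.sum _ fun k => (PolyGrowth.const (a k * c k)).mul (p2 k)
  have pT2 : PolyGrowth T2 := (PolyGrowth.const 3).mul (PolyGrowth.sum _ fun k =>
    PolyGrowth.sum _ fun l => (PolyGrowth.const (a k * a l * r k l)).mul ((p2 k).mul (p2 l)))
  set Φ : ℝ → (κ → ℝ) → ℂ := fun θ y => Complex.exp ((y o + θ * F y : ℝ) * Complex.I) with hΦ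
  have hcont : ∀ θ : ℝ, Continuous fun y : κ → ℝ => y o + θ * F y := fun θ =>
    (continuous_apply o).add (continuous_const.mul pF.1)
  have pΦ : ∀ θ z, PolyGrowth fun y => z * Φ θ y := fun θ z =>
    PolyGrowth.cexp_mul_I (hcont θ) z
  have pΦ1 : ∀ θ, PolyGrowth (Φ θ) := fun θ => by simpa using pΦ θ 1
  have nΦ : ∀ θ y, ‖Φ θ y‖ = 1 := fun θ y => Complex.norm_exp_ofReal_mul_I _
  -- the derivative of the characteristic function in the second variable
  have hstein : ∀ θ, ∫ y, F y • (Complex.I * Φ θ y) ∂μ =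
      - ∫ y, (T1 y + θ * T2 y) • Φ θ y ∂μ := by
    intro θ
    have h3 : ∀ k, ∫ y, (y (e k) ^ 3 - 3 * y (e k)) • Φ θ y ∂μ =
        ∫ y, ((y (e k) ^ 2 - 1) * (c k + 3 * θ * ∑ l, a l * r k l * (y (e l) ^ 2 - 1))) •
          (Complex.I * Φ θ y) ∂μ := by
      intro k
      refine integral_hermite_three_smul_cexp hc (hk k) (hcont θ)
        ((PolyGrowth.const (c k)).add ((PolyGrowth.const (3 * θ)).mul (PolyGrowth.sum _ fun l =>
          (PolyGrowth.const (a l * r k l)).mul (p2 l)))) (fun y => ?_)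
      have hh : ∀ l, HasDerivAt (fun x : ℝ => a l * ((y + x • fun j => ∫ z, z (e k) * z j ∂μ) (e l)
          ^ 3 - 3 * (y + x • fun j => ∫ z, z (e k) * z j ∂μ) (e l)))
          (a l * (3 * y (e l) ^ 2 * r k l - 3 * r k l)) 0 := fun l => by
        have h := hasDerivAt_eval_line y (fun j => ∫ z, z (e k) * z j ∂μ) (e l)
        refine (((h.fun_pow 3).fun_sub (h.const_mul 3)).const_mul (a l)).congr_deriv ?_
        simp [hr]
      refine ((hasDerivAt_eval_line y _ o).fun_add
        ((HasDerivAt.fun_sum fun l _ => hh l).const_mul θ)).congr_deriv ?_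
      simp only [hcdef, Finset.mul_sum]
      congr 1
      exact Finset.sum_congr rfl fun l _ => by ring
    have pg : ∀ k, PolyGrowth fun y : κ → ℝ => a k • ((y (e k) ^ 3 - 3 * y (e k)) • Φ θ y) :=
      fun k => (PolyGrowth.const (a k)).smul
        ((((p1 k).pow 3).sub ((PolyGrowth.const 3).mul (p1 k))).smul (pΦ1 θ))
    have pg' : ∀ k, PolyGrowth fun y : κ → ℝ => a k • (((y (e k) ^ 2 - 1) *
        (c k + 3 * θ * ∑ l, a l * r k l * (y (e l) ^ 2 - 1))) • (Complex.I * Φ θ y)) :=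
      fun k => (PolyGrowth.const (a k)).smul (((p2 k).mul ((PolyGrowth.const (c k)).add
        ((PolyGrowth.const (3 * θ)).mul (PolyGrowth.sum _ fun l =>
          (PolyGrowth.const (a l * r k l)).mul (p2 l))))).smul (pΦ θ Complex.I))
    have h4 : ∫ y, F y • Φ θ y ∂μ = ∫ y, (T1 y + θ * T2 y) • (Complex.I * Φ θ y) ∂μ := by
      have e1 : ∀ y, F y • Φ θ y = ∑ k, a k • ((y (e k) ^ 3 - 3 * y (e k)) • Φ θ y) := fun y => by
        simp only [hF, Finset.sum_smul, smul_smul]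
      have e2 : ∀ y, (T1 y + θ * T2 y) • (Complex.I * Φ θ y) = ∑ k, a k • (((y (e k) ^ 2 - 1) *
          (c k + 3 * θ * ∑ l, a l * r k l * (y (e l) ^ 2 - 1))) • (Complex.I * Φ θ y)) := by
        intro y
        simp only [smul_smul, ← Finset.sum_smul]
        congr 1
        simp only [hT1, hT2, Finset.mul_sum, ← Finset.sum_add_distrib, mul_add]
        refine Finset.sum_congr rfl fun k _ => ?_
        congr 1
        · ring
        · exact Finset.sum_congr rfl fun l _ => by ring
      simp only [e1, e2]
      rw [integral_finsetSum _ fun k _ => (pg k).integrable μ,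
        integral_finsetSum _ fun k _ => (pg' k).integrable μ]
      refine Finset.sum_congr rfl fun k _ => ?_
      rw [integral_smul, integral_smul, h3]
    have e3 : ∀ y, F y • (Complex.I * Φ θ y) = Complex.I * (F y • Φ θ y) := fun y => by
      simp only [Complex.real_smul]; ring
    have e4 : ∀ y, (T1 y + θ * T2 y) • (Complex.I * Φ θ y) =
        Complex.I * ((T1 y + θ * T2 y) • Φ θ y) := fun y => by
      simp only [Complex.real_smul]; ring
    simp only [e3, e4] at h4 ⊢
    rw [integral_const_mul] at h4 ⊢
    rw [h4, ← mul_assoc, Complex.I_mul_I, neg_one_mul]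
  have hder : ∀ θ, HasDerivAt (fun θ => ∫ y, Φ θ y ∂μ) (∫ y, F y • (Complex.I * Φ θ y) ∂μ) θ := by
    intro θ
    refine (hasDerivAt_integral_of_dominated_loc_of_deriv_le (F := Φ)
      (F' := fun θ y => F y • (Complex.I * Φ θ y)) (bound := fun y => |F y|) (s := Set.univ)
      Filter.univ_mem (Eventually.of_forall fun θ => (pΦ1 θ).1.aestronglyMeasurable)
      ((pΦ1 θ).integrable μ) (pF.smul (pΦ θ Complex.I)).1.aestronglyMeasurable
      (ae_of_all _ fun y θ _ => ?_) (pF.integrable μ).abs (ae_of_all _ fun y θ _ => ?_)).2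
    · rw [norm_smul, norm_mul, nΦ]; simp
    · have h1 : HasDerivAt (fun θ : ℝ => y o + θ * F y) (F y) θ := by
        simpa using ((hasDerivAt_id θ).mul_const (F y)).const_add (y o)
      refine (h1.ofReal_comp.mul_const Complex.I).cexp.congr_deriv ?_
      simp only [Complex.real_smul, hΦ]; ring
  set ψ : ℝ → ℂ := fun θ => Complex.exp ((θ ^ 2 * σ2 / 2 : ℝ)) * ∫ y, Φ θ y ∂μ with hψ
  have hψd : ∀ θ, HasDerivAt ψ (Complex.exp ((θ ^ 2 * σ2 / 2 : ℝ)) *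
      - ∫ y, (T1 y + θ * (T2 y - σ2)) • Φ θ y ∂μ) θ := by
    intro θ
    have h1 : HasDerivAt (fun θ : ℝ => θ ^ 2 * σ2 / 2) (θ * σ2) θ := by
      refine ((((hasDerivAt_id' θ).fun_pow 2).mul_const σ2).div_const 2).congr_deriv ?_
      simp; ring
    refine (h1.ofReal_comp.cexp.fun_mul (hder θ)).congr_deriv ?_
    rw [hstein]
    have e1 : ∀ y, (T1 y + θ * (T2 y - σ2)) • Φ θ y =
        (T1 y + θ * T2 y) • Φ θ y - ((θ * σ2 : ℝ) : ℂ) * Φ θ y := fun y => by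
      simp only [Complex.real_smul]; push_cast; ring
    simp only [e1]
    rw [integral_sub (((pT1.add ((PolyGrowth.const θ).mul pT2)).smul (pΦ1 θ)).integrable μ)
      ((pΦ θ _).integrable μ), integral_const_mul]
    ring
  have hbound : ∀ θ ∈ Set.Icc (0 : ℝ) 1, ‖Complex.exp ((θ ^ 2 * σ2 / 2 : ℝ)) *
      - ∫ y, (T1 y + θ * (T2 y - σ2)) • Φ θ y ∂μ‖ ≤ Real.exp (|σ2| / 2) * (A + Q) := by
    intro θ hθ
    rw [norm_mul, norm_neg, Complex.norm_exp_ofReal]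
    have hθ2 : θ ^ 2 ≤ 1 := by nlinarith [hθ.1, hθ.2]
    refine mul_le_mul (Real.exp_le_exp.2 ?_) ?_ (norm_nonneg _) (Real.exp_nonneg _)
    · have := mul_le_mul_of_nonneg_left (le_abs_self σ2) (sq_nonneg θ)
      have := mul_le_mul_of_nonneg_right hθ2 (abs_nonneg σ2)
      linarith
    · have iT := (pT1.integrable μ).abs
      have iQ := ((pT2.sub (PolyGrowth.const σ2)).integrable μ).abs
      calc _ ≤ ∫ y, (|T1 y| + |T2 y - σ2|) ∂μ := by
            refine norm_integral_le_of_norm_le (iT.add iQ) (ae_of_all _ fun y => ?_)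
            rw [norm_smul, nΦ, mul_one, Real.norm_eq_abs]
            refine (abs_add_le _ _).trans ?_
            rw [abs_mul, abs_of_nonneg hθ.1]
            have := mul_le_mul_of_nonneg_right hθ.2 (abs_nonneg (T2 y - σ2))
            linarith
        _ = ∫ y, |T1 y| ∂μ + ∫ y, |T2 y - σ2| ∂μ := integral_add iT iQ
        _ ≤ A + Q := add_le_add hA hQ
  have hmvt := Convex.norm_image_sub_le_of_norm_hasDerivWithin_le
    (fun θ hθ => (hψd θ).hasDerivWithinAt) hbound (convex_Icc (0 : ℝ) 1)
    (Set.left_mem_Icc.2 zero_le_one) (Set.right_mem_Icc.2 zero_le_one)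
  have hψ0 : ψ 0 = ∫ y, Complex.exp ((y o : ℝ) * Complex.I) ∂μ := by
    simp [hψ, hΦ]
  have hψ1 : ψ 1 = Complex.exp ((σ2 / 2 : ℝ)) * ∫ y, Φ 1 y ∂μ := by simp [hψ]
  have hΦ1 : ∀ y, Φ 1 y = Complex.exp ((y o + F y : ℝ) * Complex.I) := fun y => by
    simp [hΦ]
  have hfin : ∫ y, Φ 1 y ∂μ - Complex.exp (-(σ2 : ℂ) / 2) *
      ∫ y, Complex.exp ((y o : ℝ) * Complex.I) ∂μ =
      Complex.exp ((-σ2 / 2 : ℝ)) * (ψ 1 - ψ 0) := by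
    rw [mul_sub, hψ1, ← mul_assoc, ← Complex.exp_add, hψ0]
    have : ((-σ2 / 2 : ℝ) : ℂ) + ((σ2 / 2 : ℝ) : ℂ) = 0 := by push_cast; ring
    rw [this, Complex.exp_zero, one_mul]
    push_cast; rfl
  change ‖∫ y, Complex.exp ((y o + F y : ℝ) * Complex.I) ∂μ - _‖ ≤ _
  simp only [← hΦ1]
  rw [hfin, norm_mul, Complex.norm_exp_ofReal]
  have hexp : Real.exp |σ2| = Real.exp (|σ2| / 2) * Real.exp (|σ2| / 2) := by
    rw [← Real.exp_add]; congr 1; ring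
  rw [hexp, mul_assoc]
  refine mul_le_mul (Real.exp_le_exp.2 ?_) (by simpa using hmvt) (norm_nonneg _)
    (Real.exp_nonneg _)
  have := neg_abs_le σ2
  linarith

end Chaos

/-- The correlation function of the increments of fractional Brownian motion with Hurst
parameter `1/6` over the integers. -/
def incrementCorr (r : ℤ) : ℝ :=
  (|(r : ℝ) + 1| ^ ((1 : ℝ) / 3) + |(r : ℝ) - 1| ^ ((1 : ℝ) / 3)
    - 2 * |(r : ℝ)| ^ ((1 : ℝ) / 3)) / 2

lemma kappaTerm_eq (r : ℤ) : kappaTerm r = 8 * incrementCorr r ^ 3 := by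
  simp only [kappaTerm, incrementCorr]; ring

lemma incrementCorr_neg (r : ℤ) : incrementCorr (-r) = incrementCorr r := by
  simp only [incrementCorr, Int.cast_neg, abs_neg]
  rw [show -(r : ℝ) + 1 = -(r - 1) by ring, show -(r : ℝ) - 1 = -(r + 1) by ring, abs_neg, abs_neg]
  ring

lemma incrementCorr_nat_succ (n : ℕ) : incrementCorr ((n + 1 : ℕ) : ℤ) =
    -((((n : ℝ) + 1) ^ ((1 : ℝ) / 3) - (n : ℝ) ^ ((1 : ℝ) / 3)) -
      (((n : ℝ) + 2) ^ ((1 : ℝ) / 3) - ((n : ℝ) + 1) ^ ((1 : ℝ) / 3))) / 2 := by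
  have h : (0 : ℝ) ≤ n := n.cast_nonneg
  simp only [incrementCorr]
  push_cast
  rw [abs_of_nonneg (by linarith), abs_of_nonneg (by linarith), abs_of_nonneg (by linarith)]
  rw [show (n : ℝ) + 1 + 1 = n + 2 by ring, show (n : ℝ) + 1 - 1 = n by ring]
  ring

lemma incrementCorr_nat_succ_nonpos (n : ℕ) : incrementCorr ((n + 1 : ℕ) : ℤ) ≤ 0 := by
  have h : (0 : ℝ) ≤ n := n.cast_nonneg
  have hconc := Real.concaveOn_rpow (p := (1 : ℝ) / 3) (by norm_num) (by norm_num)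
  have hc := hconc.2 (show (n : ℝ) ∈ Set.Ici 0 from h)
    (show (n : ℝ) + 2 ∈ Set.Ici 0 by simp only [Set.mem_Ici]; linarith)
    (show (0 : ℝ) ≤ 1 / 2 by norm_num) (show (0 : ℝ) ≤ 1 / 2 by norm_num) (by norm_num)
  simp only [smul_eq_mul] at hc
  rw [show 1 / 2 * (n : ℝ) + 1 / 2 * ((n : ℝ) + 2) = n + 1 by ring] at hc
  rw [incrementCorr_nat_succ]
  linarith

lemma summable_abs_incrementCorr : Summable fun r : ℤ => |incrementCorr r| := by
  have hnat : Summable fun n : ℕ => |incrementCorr (n : ℤ)| := by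
    rw [← summable_nat_add_iff 1]
    refine summable_of_sum_range_le (c := 1 / 2) (fun n => abs_nonneg _) fun n => ?_
    have ht : ∀ n : ℕ, |incrementCorr ((n + 1 : ℕ) : ℤ)| =
        ((((n : ℝ) + 1) ^ ((1 : ℝ) / 3) - (n : ℝ) ^ ((1 : ℝ) / 3)) / 2) -
        ((((n + 1 : ℕ) : ℝ) + 1) ^ ((1 : ℝ) / 3) - ((n + 1 : ℕ) : ℝ) ^ ((1 : ℝ) / 3)) / 2 := by
      intro n
      rw [abs_of_nonpos (incrementCorr_nat_succ_nonpos n), incrementCorr_nat_succ]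
      push_cast
      rw [show (n : ℝ) + 1 + 1 = n + 2 by ring]
      ring
    simp only [ht]
    rw [Finset.sum_range_sub' (fun n : ℕ =>
      (((n : ℝ) + 1) ^ ((1 : ℝ) / 3) - (n : ℝ) ^ ((1 : ℝ) / 3)) / 2)]
    have hm : (n : ℝ) ^ ((1 : ℝ) / 3) ≤ ((n : ℝ) + 1) ^ ((1 : ℝ) / 3) :=
      Real.rpow_le_rpow n.cast_nonneg (by linarith) (by norm_num)
    simp
    linarith
  exact Summable.of_nat_of_neg hnat (by simpa only [incrementCorr_neg] using hnat)

lemma card_filter_sub_eq (N M : ℕ) (r : ℤ) :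
    (((Finset.range N ×ˢ Finset.range M).filter fun p => (p.1 : ℤ) - p.2 = r).card : ℤ) =
      max 0 (min (N : ℤ) (M + r) - max 0 r) := by
  have : ((Finset.range N ×ˢ Finset.range M).filter fun p => (p.1 : ℤ) - p.2 = r).card =
      (Finset.Ico (max 0 r) (min (N : ℤ) (M + r))).card := by
    refine Finset.card_nbij' (fun p => (p.1 : ℤ)) (fun k => (k.toNat, (k - r).toNat)) ?_ ?_ ?_ ?_
    · rintro ⟨k, l⟩ h
      simp only [Finset.coe_filter, Finset.mem_product, Finset.mem_range, Set.mem_ofPred_eq,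
        Finset.coe_Ico, Set.mem_Ico] at h ⊢
      omega
    · intro k h
      simp only [Finset.coe_filter, Finset.mem_product, Finset.mem_range, Set.mem_ofPred_eq,
        Finset.coe_Ico, Set.mem_Ico] at h ⊢
      omega
    · rintro ⟨k, l⟩ h
      simp only [Finset.coe_filter, Finset.mem_product, Finset.mem_range, Set.mem_ofPred_eq] at h
      simp only [Prod.mk.injEq]
      omega
    · intro k h
      simp only [Finset.coe_Ico, Set.mem_Ico] at h
      simp only
      omega
  rw [this, Int.card_Ico]
  omega

/-- Cesàro-type limit for Toeplitz double sums over growing rectangles. -/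
lemma tendsto_toeplitz_sum {f : ℤ → ℝ} (hf : Summable fun r => |f r|) {s t : ℝ} (hs : 0 ≤ s)
    (ht : 0 ≤ t) :
    Tendsto (fun n : ℕ => (1 / (n : ℝ)) * ∑ k ∈ Finset.range ⌊(n : ℝ) * s⌋₊,
      ∑ l ∈ Finset.range ⌊(n : ℝ) * t⌋₊, f ((k : ℤ) - l)) atTop (𝓝 (min s t * ∑' r, f r)) := by
  set c : ℕ → ℤ → ℝ := fun n r => (((Finset.range ⌊(n : ℝ) * s⌋₊ ×ˢ
    Finset.range ⌊(n : ℝ) * t⌋₊).filter fun p => (p.1 : ℤ) - p.2 = r).card : ℝ) with hc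
  have hsum : ∀ n : ℕ, (1 / (n : ℝ)) * ∑ k ∈ Finset.range ⌊(n : ℝ) * s⌋₊,
      ∑ l ∈ Finset.range ⌊(n : ℝ) * t⌋₊, f ((k : ℤ) - l) = ∑' r, (c n r / n) * f r := by
    intro n
    rw [← Finset.sum_product' (f := fun k l : ℕ => f ((k : ℤ) - l)),
      Finset.sum_comp f (fun p : ℕ × ℕ => (p.1 : ℤ) - p.2), tsum_eq_sum, Finset.mul_sum]
    · refine Finset.sum_congr rfl fun r _ => ?_
      rw [nsmul_eq_mul]; ring
    · intro r hr
      have : c n r = 0 := by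
        simp only [hc, Nat.cast_eq_zero, Finset.card_eq_zero]
        refine Finset.filter_eq_empty_iff.2 fun p hp h => hr ?_
        exact Finset.mem_image.2 ⟨p, hp, h⟩
      simp [this]
  have hcr : ∀ n r, c n r = max 0 (min (⌊(n : ℝ) * s⌋₊ : ℝ) (⌊(n : ℝ) * t⌋₊ + r) - max 0 (r : ℝ)) := by
    intro n r
    have := card_filter_sub_eq ⌊(n : ℝ) * s⌋₊ ⌊(n : ℝ) * t⌋₊ r
    have h2 := congrArg (Int.cast (R := ℝ)) this
    push_cast at h2
    rw [← h2]
  have hfl : ∀ {u : ℝ}, 0 ≤ u → Tendsto (fun n : ℕ => (⌊(n : ℝ) * u⌋₊ : ℝ) / n) atTop (𝓝 u) := by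
    intro u hu
    have := (tendsto_nat_floor_mul_div_atTop (R := ℝ) hu).comp tendsto_natCast_atTop_atTop
    simpa [Function.comp_def, mul_comm] using this
  simp only [hsum]
  rw [← tsum_mul_left]
  refine tendsto_tsum_of_dominated_convergence (bound := fun r => s * |f r|) (hf.mul_left s)
    (fun r => ?_) (Eventually.of_forall fun n r => ?_)
  · refine Tendsto.mul_const _ ?_
    have hr0 : Tendsto (fun n : ℕ => (r : ℝ) / n) atTop (𝓝 0) :=
      tendsto_const_nhds.div_atTop tendsto_natCast_atTop_atTop
    have hlim : Tendsto (fun n : ℕ => max 0 (min ((⌊(n : ℝ) * s⌋₊ : ℝ) / n)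
        ((⌊(n : ℝ) * t⌋₊ : ℝ) / n + r / n) - max 0 ((r : ℝ) / n))) atTop
        (𝓝 (max 0 (min s (t + 0) - max 0 0))) :=
      tendsto_const_nhds.max (((hfl hs).min ((hfl ht).add hr0)).sub (tendsto_const_nhds.max hr0))
    rw [add_zero, max_self, sub_zero, max_eq_right (le_min hs ht)] at hlim
    refine hlim.congr fun n => ?_
    rw [hcr, ← add_div, min_div_div_right n.cast_nonneg]
    have : (0 : ℝ) = 0 / n := by simp
    conv_lhs => rw [this]
    rw [max_div_div_right n.cast_nonneg, ← sub_div, max_div_div_right n.cast_nonneg]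
  · rw [norm_mul, Real.norm_eq_abs, Real.norm_eq_abs]
    refine mul_le_mul_of_nonneg_right ?_ (abs_nonneg _)
    have h1 : c n r ≤ ⌊(n : ℝ) * s⌋₊ := by
      rw [hcr]
      refine max_le (Nat.cast_nonneg _) ?_
      have := min_le_left (⌊(n : ℝ) * s⌋₊ : ℝ) (⌊(n : ℝ) * t⌋₊ + r)
      have := le_max_left (0 : ℝ) (r : ℝ)
      linarith
    have h2 : c n r ≤ n * s := h1.trans (Nat.floor_le (by positivity))
    have h3 : 0 ≤ c n r := Nat.cast_nonneg _
    rw [abs_of_nonneg (by positivity)]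
    rcases Nat.eq_zero_or_pos n with rfl | hn
    · simpa using hs
    · rw [div_le_iff₀ (by positivity)]; linarith

lemma abs_rpow_third_sub_le {x y : ℝ} (hx : 0 ≤ x) (hy : 0 ≤ y) :
    |x ^ ((1 : ℝ) / 3) - y ^ ((1 : ℝ) / 3)| ≤ |x - y| ^ ((1 : ℝ) / 3) := by
  have key : ∀ {x y : ℝ}, 0 ≤ x → x ≤ y →
      y ^ ((1 : ℝ) / 3) - x ^ ((1 : ℝ) / 3) ≤ (y - x) ^ ((1 : ℝ) / 3) := by
    intro x y hx h
    have := Real.rpow_add_le_add_rpow (p := 1 / 3) hx (sub_nonneg.2 h) (by norm_num) (by norm_num)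
    rw [add_sub_cancel] at this
    linarith
  have mono : ∀ {x y : ℝ}, 0 ≤ x → x ≤ y → x ^ ((1 : ℝ) / 3) ≤ y ^ ((1 : ℝ) / 3) :=
    fun hx h => Real.rpow_le_rpow hx h (by norm_num)
  rcases le_total x y with h | h
  · rw [abs_sub_comm, abs_of_nonneg (sub_nonneg.2 (mono hx h)), abs_sub_comm x y,
      abs_of_nonneg (sub_nonneg.2 h)]
    exact key hx h
  · rw [abs_of_nonneg (sub_nonneg.2 (mono hy h)), abs_of_nonneg (sub_nonneg.2 h)]
    exact key hy h

section GaussianSpan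

variable {Ω : Type*} [MeasurableSpace Ω] {P : Measure Ω} {X : ℝ → Ω → ℝ}

lemma exists_map_eq_gaussianReal_of_mem_span (hm : ∀ t, Measurable (X t))
    (hX : ∀ (m : ℕ) (t : Fin m → ℝ) (c : Fin m → ℝ), (∀ i, 0 ≤ t i) →
      ∃ v : NNReal, Measure.map (fun ω => ∑ i, c i * X (t i) ω) P = gaussianReal 0 v)
    {Y : Ω → ℝ} (hY : Y ∈ Submodule.span ℝ (X '' Set.Ici 0)) :
    Measurable Y ∧ ∃ v : NNReal, P.map Y = gaussianReal 0 v := by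
  obtain ⟨n, f, g, rfl⟩ := Submodule.mem_span_set'.1 hY
  choose t ht htg using fun i => (g i).2
  have e : (∑ i, f i • (g i : Ω → ℝ)) = fun ω => ∑ i, f i * X (t i) ω := by
    ext ω; simp [htg]
  rw [e]
  exact ⟨Finset.measurable_fun_sum _ fun i _ => (hm _).const_mul _, hX n t f ht⟩

lemma isGaussian_map_of_mem_span {κ : Type*} [Fintype κ] (hm : ∀ t, Measurable (X t))
    (hX : ∀ (m : ℕ) (t : Fin m → ℝ) (c : Fin m → ℝ), (∀ i, 0 ≤ t i) →
      ∃ v : NNReal, Measure.map (fun ω => ∑ i, c i * X (t i) ω) P = gaussianReal 0 v)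
    {Y : κ → Ω → ℝ} (hY : ∀ k, Y k ∈ Submodule.span ℝ (X '' Set.Ici 0)) :
    IsGaussian (P.map fun ω k => Y k ω) := by
  classical
  refine isGaussian_of_map_eq_gaussianReal fun L => ⟨0, ?_⟩
  have hYm : Measurable fun ω k => Y k ω :=
    measurable_pi_lambda _ fun k => (exists_map_eq_gaussianReal_of_mem_span hm hX (hY k)).1
  rw [Measure.map_map L.continuous.measurable hYm]
  have e : (L ∘ fun ω k => Y k ω) = ∑ k, L (Pi.single k 1) • Y k := by
    ext ω
    have := L.toLinearMap.pi_apply_eq_sum_univ (fun k => Y k ω)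
    simp only [Function.comp_apply, Finset.sum_apply, Pi.smul_apply, smul_eq_mul]
    refine this.trans (Finset.sum_congr rfl fun k _ => ?_)
    rw [smul_eq_mul, mul_comm]
    have hk : (fun j => if k = j then (1 : ℝ) else 0) = Pi.single k 1 := by
      ext j; simp [Pi.single_apply, eq_comm]
    rw [hk]; rfl
  rw [e]
  exact (exists_map_eq_gaussianReal_of_mem_span hm hX
    (Submodule.sum_mem _ fun k _ => Submodule.smul_mem _ _ (hY k))).2

lemma memLp_two_of_mem_span (hm : ∀ t, Measurable (X t))
    (hX : ∀ (m : ℕ) (t : Fin m → ℝ) (c : Fin m → ℝ), (∀ i, 0 ≤ t i) →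
      ∃ v : NNReal, Measure.map (fun ω => ∑ i, c i * X (t i) ω) P = gaussianReal 0 v)
    {Y : Ω → ℝ} (hY : Y ∈ Submodule.span ℝ (X '' Set.Ici 0)) :
    MemLp Y 2 P ∧ ∫ ω, Y ω ∂P = 0 := by
  obtain ⟨hYm, v, hv⟩ := exists_map_eq_gaussianReal_of_mem_span hm hX hY
  constructor
  · have := memLp_id_gaussianReal' (μ := 0) (v := v) 2 (by simp)
    rw [← hv] at this
    exact this.comp_of_map hYm.aemeasurable
  · have h := integral_map hYm.aemeasurable (f := fun x : ℝ => x) (μ := P)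
      (by fun_prop)
    rw [hv, integral_id_gaussianReal] at h
    exact h.symm

end GaussianSpan

namespace IsFBM16

lemma mem_span {Ω : Type*} {B : ℝ → Ω → ℝ} {u : ℝ} (hu : 0 ≤ u) :
    B u ∈ Submodule.span ℝ (B '' Set.Ici 0) :=
  Submodule.subset_span ⟨u, hu, rfl⟩

variable {Ω : Type*} [MeasureSpace Ω] {B : ℝ → Ω → ℝ}

lemma integrable_mul (hB : IsFBM16 B) {Y Z : Ω → ℝ}
    (hY : Y ∈ Submodule.span ℝ (B '' Set.Ici 0)) (hZ : Z ∈ Submodule.span ℝ (B '' Set.Ici 0)) :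
    Integrable fun ω => Y ω * Z ω :=
  (memLp_two_of_mem_span hB.1 hB.2.2.1 hY).1.integrable_mul
    (memLp_two_of_mem_span hB.1 hB.2.2.1 hZ).1

lemma integral_sub_mul (hB : IsFBM16 B) {u v w : ℝ} (hu : 0 ≤ u) (hv : 0 ≤ v) (hw : 0 ≤ w) :
    ∫ ω, (B u ω - B v ω) * B w ω = (u ^ ((1 : ℝ) / 3) - v ^ ((1 : ℝ) / 3)
      - (|u - w| ^ ((1 : ℝ) / 3) - |v - w| ^ ((1 : ℝ) / 3))) / 2 := by
  simp only [sub_mul]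
  rw [integral_sub (hB.integrable_mul (mem_span hu) (mem_span hw))
    (hB.integrable_mul (mem_span hv) (mem_span hw)), hB.2.2.2 u w hu hw, hB.2.2.2 v w hv hw,
    abs_sub_comm w, abs_sub_comm w]
  ring

lemma abs_integral_sub_mul_le (hB : IsFBM16 B) {u v w : ℝ} (hu : 0 ≤ u) (hv : 0 ≤ v)
    (hw : 0 ≤ w) : |∫ ω, (B u ω - B v ω) * B w ω| ≤ |u - v| ^ ((1 : ℝ) / 3) := by
  rw [hB.integral_sub_mul hu hv hw]
  have h1 := abs_rpow_third_sub_le hu hv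
  have h2 := abs_rpow_third_sub_le (abs_nonneg (u - w)) (abs_nonneg (v - w))
  have h3 : |(|u - w| - |v - w|)| ^ ((1 : ℝ) / 3) ≤ |u - v| ^ ((1 : ℝ) / 3) := by
    refine Real.rpow_le_rpow (abs_nonneg _) ?_ (by norm_num)
    have := abs_abs_sub_abs_le_abs_sub (u - w) (v - w)
    rwa [sub_sub_sub_cancel_right] at this
  rw [abs_div, abs_two]
  have h4 := abs_sub (u ^ ((1 : ℝ) / 3) - v ^ ((1 : ℝ) / 3))
    (|u - w| ^ ((1 : ℝ) / 3) - |v - w| ^ ((1 : ℝ) / 3))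
  linarith

lemma integral_sub_mul_sub (hB : IsFBM16 B) {u v u' v' : ℝ} (hu : 0 ≤ u) (hv : 0 ≤ v)
    (hu' : 0 ≤ u') (hv' : 0 ≤ v') :
    ∫ ω, (B u ω - B v ω) * (B u' ω - B v' ω) =
      (|u - v'| ^ ((1 : ℝ) / 3) + |v - u'| ^ ((1 : ℝ) / 3) - |u - u'| ^ ((1 : ℝ) / 3)
        - |v - v'| ^ ((1 : ℝ) / 3)) / 2 := by
  have hs := Submodule.sub_mem _ (mem_span (B := B) hu) (mem_span (B := B) hv)
  have i1 : Integrable fun ω => (B u ω - B v ω) * B u' ω := hB.integrable_mul hs (mem_span hu')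
  have i2 : Integrable fun ω => (B u ω - B v ω) * B v' ω := hB.integrable_mul hs (mem_span hv')
  simp only [mul_sub]
  rw [integral_sub i1 i2,
    hB.integral_sub_mul hu hv hu', hB.integral_sub_mul hu hv hv']
  ring

lemma integral_abs_sub_zero_le (hB : IsFBM16 B) [IsProbabilityMeasure (volume : Measure Ω)]
    {u : ℝ} (hu : 0 ≤ u) :
    ∫ ω, |B u ω - B 0 ω| ≤ 1 + u ^ ((1 : ℝ) / 3) := by
  have hs := Submodule.sub_mem _ (mem_span (B := B) hu) (mem_span (B := B) le_rfl)
  have h := hB.integral_sub_mul_sub hu le_rfl hu le_rfl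
  simp only [sub_self, abs_zero, sub_zero, zero_sub, abs_neg, abs_of_nonneg hu] at h
  rw [Real.zero_rpow (by norm_num)] at h
  have h2 : ∫ ω, (B u ω - B 0 ω) * (B u ω - B 0 ω) = u ^ ((1 : ℝ) / 3) := by rw [h]; ring
  have hi := hB.integrable_mul hs hs
  calc ∫ ω, |B u ω - B 0 ω| ≤ ∫ ω, (1 + (B u ω - B 0 ω) * (B u ω - B 0 ω)) := by
        refine integral_mono_of_nonneg (ae_of_all _ fun ω => abs_nonneg _)
          ((integrable_const 1).add hi) (ae_of_all _ fun ω => ?_)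
        simp only
        rw [abs_le]; constructor <;>
          nlinarith [sq_nonneg (B u ω - B 0 ω - 1), sq_nonneg (B u ω - B 0 ω + 1)]
    _ = _ := by
        have hi' : Integrable fun ω => (B u ω - B 0 ω) * (B u ω - B 0 ω) := hi
        rw [integral_add (integrable_const 1) hi', h2]; simp

end IsFBM16

lemma sum_fin_sum_ite_mul {ι : Type*} [Fintype ι] (M : ι → ℕ) (ν : ι → ℝ) {N : ℕ}
    (hM : ∀ j, M j ≤ N) (f : ℕ → ℝ) :
    ∑ k : Fin N, (∑ j, if (k : ℕ) < M j then ν j else 0) * f k =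
      ∑ j, ν j * ∑ k ∈ Finset.range (M j), f k := by
  rw [Fin.sum_univ_eq_sum_range (fun k => (∑ j, if k < M j then ν j else 0) * f k) N]
  simp only [Finset.sum_mul]
  rw [Finset.sum_comm]
  refine Finset.sum_congr rfl fun j _ => ?_
  rw [Finset.mul_sum, ← Finset.sum_subset (Finset.range_subset_range.2 (hM j))]
  · exact Finset.sum_congr rfl fun k hk => by rw [if_pos (Finset.mem_range.1 hk)]
  · intro k _ hk
    rw [if_neg (by simpa using hk), zero_mul]

lemma sum_fin_abs_incrementCorr_le {N : ℕ} (k : Fin N) :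
    ∑ l : Fin N, |incrementCorr ((k : ℤ) - l)| ≤ ∑' r, |incrementCorr r| := by
  have hinj : Function.Injective fun l : Fin N => (k : ℤ) - l := fun l l' h => by
    have : (l : ℤ) = l' := by simpa using h
    exact Fin.ext (by exact_mod_cast this)
  have := Summable.sum_le_tsum (f := fun r => |incrementCorr r|)
    (Finset.univ.map ⟨_, hinj⟩) (fun r _ => abs_nonneg _) summable_abs_incrementCorr
  simpa using this

lemma sum_range_increments_mul {ι : Type*} [Fintype ι] (M : ι → ℕ) (ν : ι → ℝ) {N : ℕ}
    (hM : ∀ j, M j ≤ N) (h : ℝ) (f : ℤ → ℝ) :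
    ∑ k : Fin N, ∑ l : Fin N, ((∑ j, if (k : ℕ) < M j then ν j else 0) * h) *
        ((∑ j, if (l : ℕ) < M j then ν j else 0) * h) * f ((k : ℤ) - l) =
      ∑ i, ∑ j, ν i * ν j * (h ^ 2 * ∑ k ∈ Finset.range (M i), ∑ l ∈ Finset.range (M j),
        f ((k : ℤ) - l)) := by
  have h1 : ∀ k : Fin N, ∑ l : Fin N, ((∑ j, if (k : ℕ) < M j then ν j else 0) * h) *
        ((∑ j, if (l : ℕ) < M j then ν j else 0) * h) * f ((k : ℤ) - l) =
      (∑ j, if (k : ℕ) < M j then ν j else 0) *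
        (h ^ 2 * ∑ j, ν j * ∑ l ∈ Finset.range (M j), f ((k : ℤ) - l)) := by
    intro k
    rw [← sum_fin_sum_ite_mul M ν hM fun l => f ((k : ℤ) - l), Finset.mul_sum, Finset.mul_sum]
    exact Finset.sum_congr rfl fun l _ => by ring
  simp only [h1]
  rw [sum_fin_sum_ite_mul M ν hM
    fun k => h ^ 2 * ∑ j, ν j * ∑ l ∈ Finset.range (M j), f ((k : ℤ) - l)]
  refine Finset.sum_congr rfl fun i _ => ?_
  rw [← Finset.mul_sum, Finset.sum_comm, Finset.mul_sum, Finset.mul_sum]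
  refine Finset.sum_congr rfl fun j _ => ?_
  rw [← Finset.mul_sum]; ring

lemma abs_incrementCorr_le_one (r : ℤ) : |incrementCorr r| ≤ 1 := by
  have key : ∀ n : ℕ, |incrementCorr (n : ℤ)| ≤ 1 := by
    intro n
    have ha : (0 : ℝ) ≤ |(n : ℝ) - 1| := abs_nonneg _
    have hn : (0 : ℝ) ≤ n := n.cast_nonneg
    have h1 := abs_rpow_third_sub_le (x := (n : ℝ) + 1) (y := n) (by positivity) hn
    have h2 := abs_rpow_third_sub_le ha hn
    have h3 : |(|(n : ℝ) - 1| - n)| ≤ 1 := by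
      have := abs_abs_sub_abs_le_abs_sub ((n : ℝ) - 1) n
      rw [abs_of_nonneg hn] at this
      simpa using this
    have h4 := Real.rpow_le_one (abs_nonneg _) h3 (z := (1 : ℝ) / 3) (by norm_num)
    rw [add_sub_cancel_left, abs_one, Real.one_rpow] at h1
    unfold incrementCorr
    push_cast
    rw [abs_of_nonneg (by positivity : (0 : ℝ) ≤ n + 1), abs_of_nonneg hn]
    rw [abs_le] at h1 ⊢
    have h5 := abs_le.1 (h2.trans h4)
    constructor <;> linarith [h1.1, h1.2, h5.1, h5.2]
  obtain ⟨n, rfl | rfl⟩ := r.eq_nat_or_neg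
  · exact key n
  · rw [incrementCorr_neg]; exact key n

lemma abs_incrementCorr_pow_three_le (r : ℤ) : |incrementCorr r ^ 3| ≤ |incrementCorr r| := by
  rw [abs_pow]
  exact pow_le_of_le_one (abs_nonneg _) (abs_incrementCorr_le_one r) (by norm_num)

lemma summable_abs_incrementCorr_pow_three : Summable fun r : ℤ => |incrementCorr r ^ 3| :=
  summable_abs_incrementCorr.of_nonneg_of_le (fun _ => abs_nonneg _)
    abs_incrementCorr_pow_three_le

lemma incrementCorr_zero : incrementCorr 0 = 1 := by
  simp [incrementCorr]

namespace IsFBM16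

variable {Ω : Type*} [MeasureSpace Ω] {B : ℝ → Ω → ℝ}

lemma integral_scaled_increments_mul (hB : IsFBM16 B) {n : ℕ} (hn : 0 < n) {h : ℝ} (h0 : 0 < h)
    (hh : ((n : ℝ)) ^ ((1 : ℝ) / 3) = h ^ 2) (k l : ℕ) :
    ∫ ω, h * (B (((k : ℝ) + 1) / n) ω - B ((k : ℝ) / n) ω) *
      (h * (B (((l : ℝ) + 1) / n) ω - B ((l : ℝ) / n) ω)) = incrementCorr ((k : ℤ) - l) := by
  have e : ∀ ω, h * (B (((k : ℝ) + 1) / n) ω - B ((k : ℝ) / n) ω) *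
      (h * (B (((l : ℝ) + 1) / n) ω - B ((l : ℝ) / n) ω)) =
      h ^ 2 * ((B (((k : ℝ) + 1) / n) ω - B ((k : ℝ) / n) ω) *
      (B (((l : ℝ) + 1) / n) ω - B ((l : ℝ) / n) ω)) := fun ω => by ring
  simp only [e]
  rw [integral_const_mul, hB.integral_sub_mul_sub (by positivity) (by positivity) (by positivity)
    (by positivity)]
  have hd : ∀ x : ℝ, |x / n| ^ ((1 : ℝ) / 3) = |x| ^ ((1 : ℝ) / 3) / h ^ 2 := by
    intro x
    rw [abs_div, Real.div_rpow (abs_nonneg _) (abs_nonneg _), Nat.abs_cast, hh]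
  simp only [← sub_div, hd]
  unfold incrementCorr
  push_cast
  rw [show (k : ℝ) + 1 - l = k - l + 1 by ring, show (k : ℝ) - (l + 1) = k - l - 1 by ring,
    show (k : ℝ) + 1 - (l + 1) = k - l by ring]
  field_simp
  ring

lemma norm_integral_cexp_add_sum_sub_le (hB : IsFBM16 B)
    [IsProbabilityMeasure (volume : Measure Ω)] {n : ℕ} (hn : 0 < n) {h : ℝ} (h0 : 0 < h)
    (hh : ((n : ℝ)) ^ ((1 : ℝ) / 3) = h ^ 2) {G : Ω → ℝ}
    (hG : G ∈ Submodule.span ℝ (B '' Set.Ici 0)) {Λ : ℝ}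
    (hΛ : ∀ u v : ℝ, 0 ≤ u → 0 ≤ v →
      |∫ ω, (B u ω - B v ω) * G ω| ≤ Λ * |u - v| ^ ((1 : ℝ) / 3))
    {N : ℕ} (a : Fin N → ℝ) {α : ℝ} (ha : ∀ k, |a k| ≤ α) {σ2 : ℝ}
    (hσ : σ2 = 6 * ∑ k, ∑ l, a k * a l * incrementCorr ((k : ℤ) - l) ^ 3) :
    ‖(∫ ω, Complex.exp ((G ω + ∑ k : Fin N, a k *
        ((h * (B (((k : ℝ) + 1) / n) ω - B ((k : ℝ) / n) ω)) ^ 3 -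
          3 * (h * (B (((k : ℝ) + 1) / n) ω - B ((k : ℝ) / n) ω))) : ℝ) * Complex.I)) -
      Complex.exp (-(σ2 : ℂ) / 2) * ∫ ω, Complex.exp ((G ω : ℝ) * Complex.I)‖ ≤
    Real.exp |σ2| * (√(2 * (α * (Λ / h)) ^ 2 * N * ∑' r, |incrementCorr r|) +
      √(108 * (∫ x, (1 + x ^ 2) ^ 4 ∂gaussianReal 0 1) * α ^ 4 * N *
        (∑' r, |incrementCorr r|) ^ 3)) := by
  set X : Fin N → Ω → ℝ := fun k ω => h * (B (((k : ℝ) + 1) / n) ω - B ((k : ℝ) / n) ω) with hX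
  set Y : Option (Fin N) → Ω → ℝ := fun o => o.elim G X with hYdef
  have hXs : ∀ k, X k ∈ Submodule.span ℝ (B '' Set.Ici 0) := fun k =>
    Submodule.smul_mem _ h (Submodule.sub_mem _ (mem_span (by positivity))
      (mem_span (by positivity)))
  have hY : ∀ o, Y o ∈ Submodule.span ℝ (B '' Set.Ici 0) := by
    rintro (_ | k)
    · exact hG
    · exact hXs k
  have hYm : ∀ o, Measurable (Y o) := fun o =>
    (exists_map_eq_gaussianReal_of_mem_span hB.1 hB.2.2.1 (hY o)).1
  have hYm' : Measurable fun ω o => Y o ω := measurable_pi_lambda _ hYm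
  have := isGaussian_map_of_mem_span hB.1 hB.2.2.1 hY
  set μ := (volume : Measure Ω).map fun ω o => Y o ω with hμ
  have tr : ∀ {E : Type} [NormedAddCommGroup E] [NormedSpace ℝ E] {f : (Option (Fin N) → ℝ) → E},
      Continuous f → SecondCountableTopology E →
      ∫ y, f y ∂μ = ∫ ω, f fun o => Y o ω := fun hf _ =>
    integral_map hYm'.aemeasurable hf.aestronglyMeasurable
  have hc : ∀ o, ∫ y, y o ∂μ = 0 := fun o => by
    rw [tr (continuous_apply o) inferInstance]
    exact (memLp_two_of_mem_span hB.1 hB.2.2.1 (hY o)).2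
  have hcov : ∀ k l : Fin N, ∫ y, y (some k) * y (some l) ∂μ = incrementCorr ((k : ℤ) - l) := by
    intro k l
    rw [tr (by fun_prop) inferInstance]
    exact hB.integral_scaled_increments_mul hn h0 hh k l
  have hk : ∀ k : Fin N, ∫ y, y (some k) * y (some k) ∂μ = 1 := fun k => by
    rw [hcov, sub_self, incrementCorr_zero]
  have hγ : ∀ k : Fin N, |∫ y, y (some k) * y none ∂μ| ≤ Λ / h := by
    intro k
    rw [tr (by fun_prop) inferInstance]
    have e : ∀ ω, Y (some k) ω * Y none ω =
      h * ((B (((k : ℝ) + 1) / n) ω - B ((k : ℝ) / n) ω) * G ω) := fun ω => by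
      simp only [hYdef, hX, Option.elim]; ring
    simp only [e]
    rw [integral_const_mul, abs_mul, abs_of_pos h0]
    have h1 := hΛ (((k : ℝ) + 1) / n) ((k : ℝ) / n) (by positivity) (by positivity)
    rw [← sub_div, add_sub_cancel_left,
      abs_of_nonneg (by positivity : (0 : ℝ) ≤ 1 / n),
      Real.div_rpow (by norm_num) (by positivity), hh, Real.one_rpow] at h1
    calc _ ≤ h * (Λ * (1 / h ^ 2)) := by gcongr
      _ = _ := by field_simp
  have hS0 : 0 ≤ ∑' r, |incrementCorr r| := tsum_nonneg fun _ => abs_nonneg _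
  have hρ1 : ∀ k l : Fin N, |∫ y, y (some k) * y (some l) ∂μ| ≤ 1 := fun k l => by
    rw [hcov]; exact abs_incrementCorr_le_one _
  have hS : ∀ k : Fin N, ∑ l : Fin N, |∫ y, y (some k) * y (some l) ∂μ| ≤
      ∑' r, |incrementCorr r| := fun k => by
    simp only [hcov]; exact sum_fin_abs_incrementCorr_le k
  have b1 := integral_abs_first_term_le hc some none hk a ha hγ hρ1 hS
  have b2 := integral_abs_second_term_le hc some hk a ha hS0 hρ1 hS
  simp only [hcov] at b2
  rw [← hσ] at b2
  have b3 := norm_integral_cexp_sub_le hc some none hk a (σ2 := σ2) b1 (by simpa only [hcov] using b2)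
  rw [tr (by fun_prop) inferInstance, tr (by fun_prop) inferInstance, Fintype.card_fin] at b3
  exact b3

end IsFBM16

lemma sum_Icc_one_eq_sum_range (g : ℕ → ℝ) (M : ℕ) :
    ∑ k ∈ Finset.Icc 1 M, g k = ∑ k ∈ Finset.range M, g (k + 1) := by
  induction M with
  | zero => simp
  | succ M ih => rw [Finset.sum_Icc_succ_top (by omega), Finset.sum_range_succ, ih]

lemma norm_integral_cexp_sub_integral_cexp_le {Ω : Type*} [MeasurableSpace Ω] {P : Measure Ω}
    [IsProbabilityMeasure P] {x y : Ω → ℝ} (hx : Measurable x) (hy : Measurable y)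
    (hi : Integrable (fun ω => x ω - y ω) P) :
    ‖(∫ ω, Complex.exp ((x ω : ℝ) * Complex.I) ∂P) - ∫ ω, Complex.exp ((y ω : ℝ) * Complex.I) ∂P‖
      ≤ ∫ ω, |x ω - y ω| ∂P := by
  have key : ∀ z : Ω → ℝ, Measurable z →
      Integrable (fun ω => Complex.exp ((z ω : ℝ) * Complex.I)) P := fun z hz =>
    Integrable.of_bound (C := 1) (by fun_prop)
      (ae_of_all _ fun ω => by rw [Complex.norm_exp_ofReal_mul_I])
  rw [← integral_sub (key x hx) (key y hy)]
  refine norm_integral_le_of_norm_le hi.abs (ae_of_all _ fun ω => ?_)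
  have e : Complex.exp ((x ω : ℝ) * Complex.I) - Complex.exp ((y ω : ℝ) * Complex.I) =
      Complex.exp ((y ω : ℝ) * Complex.I) *
        (Complex.exp (Complex.I * ((x ω - y ω : ℝ) : ℂ)) - 1) := by
    rw [mul_sub, ← Complex.exp_add, mul_one]
    congr 2
    push_cast; ring
  rw [e, norm_mul, Complex.norm_exp_ofReal_mul_I, one_mul]
  exact Real.norm_exp_I_mul_ofReal_sub_one_le

namespace IsFBM16

lemma sum_cubic_variation_eq {Ω ι : Type*} [Fintype ι] {B : ℝ → Ω → ℝ} (M : ι → ℕ) (ν : ι → ℝ) {N : ℕ}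
    (hM : ∀ j, M j ≤ N) {h : ℝ} (h0 : 0 < h) (n : ℕ) (ω : Ω) :
    ∑ j, ν j * ∑ k ∈ Finset.Icc 1 (M j), (B ((k : ℝ) / n) ω - B (((k : ℝ) - 1) / n) ω) ^ 3 =
      ∑ k : Fin N, ((∑ j, if (k : ℕ) < M j then ν j else 0) * (1 / h ^ 3)) *
        ((h * (B (((k : ℝ) + 1) / n) ω - B ((k : ℝ) / n) ω)) ^ 3 -
          3 * (h * (B (((k : ℝ) + 1) / n) ω - B ((k : ℝ) / n) ω))) +
      3 / h ^ 2 * ∑ j, ν j * (B ((M j : ℝ) / n) ω - B 0 ω) := by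
  have hr := sum_fin_sum_ite_mul M ν hM fun k => (1 / h ^ 3) *
    ((h * (B (((k : ℝ) + 1) / n) ω - B ((k : ℝ) / n) ω)) ^ 3 -
          3 * (h * (B (((k : ℝ) + 1) / n) ω - B ((k : ℝ) / n) ω)))
  simp only [mul_assoc] at hr ⊢
  rw [hr, Finset.mul_sum, ← Finset.sum_add_distrib]
  refine Finset.sum_congr rfl fun j _ => ?_
  have htel : B ((M j : ℝ) / n) ω - B 0 ω =
      ∑ k ∈ Finset.range (M j), (B (((k : ℝ) + 1) / n) ω - B ((k : ℝ) / n) ω) := by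
    have := Finset.sum_range_sub (fun k : ℕ => B ((k : ℝ) / n) ω) (M j)
    simpa using this.symm
  rw [htel, sum_Icc_one_eq_sum_range, mul_left_comm, ← mul_add]
  congr 1
  rw [Finset.mul_sum, ← Finset.sum_add_distrib]
  refine Finset.sum_congr rfl fun k _ => ?_
  push_cast
  rw [add_sub_cancel_right]
  field_simp
  ring

variable {Ω : Type*} [MeasureSpace Ω] {B : ℝ → Ω → ℝ}

lemma abs_integral_sub_mul_sum_le (hB : IsFBM16 B) {ι : Type*} [Fintype ι] {t : ι → ℝ}
    (ht : ∀ i, 0 ≤ t i) (c : ι → ℝ) {u v : ℝ} (hu : 0 ≤ u) (hv : 0 ≤ v) :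
    |∫ ω, (B u ω - B v ω) * ∑ i, c i * B (t i) ω| ≤
      (∑ i, |c i|) * |u - v| ^ ((1 : ℝ) / 3) := by
  have hi : ∀ i, Integrable fun ω => (B u ω - B v ω) * B (t i) ω := fun i =>
    hB.integrable_mul (Submodule.sub_mem _ (mem_span hu) (mem_span hv)) (mem_span (ht i))
  have e : ∀ ω, (B u ω - B v ω) * ∑ i, c i * B (t i) ω =
      ∑ i, c i * ((B u ω - B v ω) * B (t i) ω) := fun ω => by
    rw [Finset.mul_sum]
    exact Finset.sum_congr rfl fun i _ => by ring
  simp only [e]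
  rw [integral_finsetSum _ fun i _ => (hi i).const_mul _, Finset.sum_mul]
  refine (Finset.abs_sum_le_sum_abs _ _).trans (Finset.sum_le_sum fun i _ => ?_)
  rw [integral_const_mul, abs_mul]
  gcongr
  exact hB.abs_integral_sub_mul_le hu hv (ht i)

lemma norm_charFun_sub_le (hB : IsFBM16 B) [IsProbabilityMeasure (volume : Measure Ω)]
    {ι ι' : Type*} [Fintype ι] [Fintype ι'] {t : ι → ℝ} (ht : ∀ i, 0 ≤ t i) (c : ι → ℝ)
    {s : ι' → ℝ} (hs : ∀ j, 0 ≤ s j) (ν : ι' → ℝ) {n : ℕ} (hn : 0 < n) {σ2 h : ℝ}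
    (hh : h = (n : ℝ) ^ ((1 : ℝ) / 6))
    (hσ : σ2 = 6 * ∑ i, ∑ j, ν i * ν j * ((1 / (n : ℝ)) *
      ∑ k ∈ Finset.range ⌊(n : ℝ) * s i⌋₊, ∑ l ∈ Finset.range ⌊(n : ℝ) * s j⌋₊,
        incrementCorr ((k : ℤ) - l) ^ 3)) :
    ‖(∫ ω, Complex.exp ((∑ i, c i * B (t i) ω + ∑ j, ν j * ∑ k ∈ Finset.Icc 1 ⌊(n : ℝ) * s j⌋₊,
        (B ((k : ℝ) / n) ω - B (((k : ℝ) - 1) / n) ω) ^ 3 : ℝ) * Complex.I)) -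
      Complex.exp (-(σ2 : ℂ) / 2) *
        ∫ ω, Complex.exp ((∑ i, c i * B (t i) ω : ℝ) * Complex.I)‖ ≤
    3 / h ^ 2 * ∑ j, |ν j| * (1 + s j ^ ((1 : ℝ) / 3)) +
    Real.exp |σ2| * (√(2 * ((∑ j, |ν j|) * ∑ i, |c i|) ^ 2 * (∑ j, s j) *
        (∑' r, |incrementCorr r|) * (1 / h ^ 2)) +
      √(108 * (∫ x, (1 + x ^ 2) ^ 4 ∂gaussianReal 0 1) * (∑ j, |ν j|) ^ 4 * (∑ j, s j) *
        (∑' r, |incrementCorr r|) ^ 3 * (1 / h ^ 6))) := by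
  have hn' : (0 : ℝ) < n := by exact_mod_cast hn
  have h0 : 0 < h := hh ▸ Real.rpow_pos_of_pos hn' _
  have hh3 : (n : ℝ) ^ ((1 : ℝ) / 3) = h ^ 2 := by
    rw [hh, ← Real.rpow_mul_natCast hn'.le]; norm_num
  have hh6 : (n : ℝ) = h ^ 6 := by
    rw [hh, ← Real.rpow_mul_natCast hn'.le]; norm_num
  set T := ∑ j, s j with hT
  have hT0 : 0 ≤ T := Finset.sum_nonneg fun j _ => hs j
  set N := ⌊(n : ℝ) * T⌋₊ with hN
  have hNle : (N : ℝ) ≤ h ^ 6 * T := hh6 ▸ Nat.floor_le (by positivity)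
  have hM : ∀ j, ⌊(n : ℝ) * s j⌋₊ ≤ N := fun j => Nat.floor_le_floor
    (mul_le_mul_of_nonneg_left (Finset.single_le_sum (fun j _ => hs j) (Finset.mem_univ j)) hn'.le)
  set V := ∑ j, |ν j| with hV
  have hV0 : 0 ≤ V := Finset.sum_nonneg fun j _ => abs_nonneg _
  set Λ := ∑ i, |c i| with hΛdef
  set S := ∑' r, |incrementCorr r| with hS
  have hS0 : 0 ≤ S := tsum_nonneg fun _ => abs_nonneg _
  set G : Ω → ℝ := fun ω => ∑ i, c i * B (t i) ω with hG
  have hGs : G ∈ Submodule.span ℝ (B '' Set.Ici 0) := by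
    have : G = ∑ i, c i • B (t i) := by ext ω; simp [hG]
    rw [this]
    exact Submodule.sum_mem _ fun i _ => Submodule.smul_mem _ _ (mem_span (ht i))
  set a : Fin N → ℝ := fun k =>
    (∑ j, if (k : ℕ) < ⌊(n : ℝ) * s j⌋₊ then ν j else 0) * (1 / h ^ 3) with ha
  have haV : ∀ k, |a k| ≤ V / h ^ 3 := by
    intro k
    rw [ha, abs_mul, abs_of_pos (by positivity : 0 < 1 / h ^ 3), mul_one_div]
    gcongr
    refine (Finset.abs_sum_le_sum_abs _ _).trans (Finset.sum_le_sum fun j _ => ?_)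
    split_ifs
    · exact le_rfl
    · simp
  have hσ' : σ2 = 6 * ∑ k, ∑ l, a k * a l * incrementCorr ((k : ℤ) - l) ^ 3 := by
    rw [hσ, ha, sum_range_increments_mul _ ν hM (1 / h ^ 3) fun r => incrementCorr r ^ 3, hh6]
    congr 1
    refine Finset.sum_congr rfl fun i _ => Finset.sum_congr rfl fun j _ => ?_
    congr 2
    ring
  have main := hB.norm_integral_cexp_add_sum_sub_le hn h0 hh3 hGs
    (fun u v hu hv => hB.abs_integral_sub_mul_sum_le ht c hu hv) a haV hσ'
  have hMs : ∀ j, 0 ≤ (⌊(n : ℝ) * s j⌋₊ : ℝ) / n ∧ (⌊(n : ℝ) * s j⌋₊ : ℝ) / n ≤ s j := fun j =>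
    ⟨by positivity, by
      rw [div_le_iff₀ hn', mul_comm (s j)]; exact Nat.floor_le (mul_nonneg hn'.le (hs j))⟩
  have hBm := hB.1
  have hint : ∀ j, Integrable fun ω => B ((⌊(n : ℝ) * s j⌋₊ : ℝ) / n) ω - B 0 ω := fun j =>
    (memLp_two_of_mem_span hB.1 hB.2.2.1 (Submodule.sub_mem _ (mem_span (hMs j).1)
      (mem_span le_rfl))).1.integrable (by norm_num)
  have herr := norm_integral_cexp_sub_integral_cexp_le (P := (volume : Measure Ω))
    (x := fun ω => G ω + ∑ j, ν j * ∑ k ∈ Finset.Icc 1 ⌊(n : ℝ) * s j⌋₊,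
        (B ((k : ℝ) / n) ω - B (((k : ℝ) - 1) / n) ω) ^ 3)
    (y := fun ω => G ω + ∑ k : Fin N, a k *
        ((h * (B (((k : ℝ) + 1) / n) ω - B ((k : ℝ) / n) ω)) ^ 3 -
          3 * (h * (B (((k : ℝ) + 1) / n) ω - B ((k : ℝ) / n) ω))))
    (by fun_prop) (by fun_prop)
  have hdiff : ∀ ω, (G ω + ∑ j, ν j * ∑ k ∈ Finset.Icc 1 ⌊(n : ℝ) * s j⌋₊,
        (B ((k : ℝ) / n) ω - B (((k : ℝ) - 1) / n) ω) ^ 3) -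
      (G ω + ∑ k : Fin N, a k *
        ((h * (B (((k : ℝ) + 1) / n) ω - B ((k : ℝ) / n) ω)) ^ 3 -
          3 * (h * (B (((k : ℝ) + 1) / n) ω - B ((k : ℝ) / n) ω)))) =
      3 / h ^ 2 * ∑ j, ν j * (B ((⌊(n : ℝ) * s j⌋₊ : ℝ) / n) ω - B 0 ω) := by
    intro ω
    rw [sum_cubic_variation_eq _ ν hM h0]
    ring
  simp only [hdiff] at herr
  have herr2 := herr ((integrable_finsetSum _ fun j _ => (hint j).const_mul _).const_mul _)
  have hbound : ∫ ω, |3 / h ^ 2 * ∑ j, ν j * (B ((⌊(n : ℝ) * s j⌋₊ : ℝ) / n) ω - B 0 ω)| ≤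
      3 / h ^ 2 * ∑ j, |ν j| * (1 + s j ^ ((1 : ℝ) / 3)) := by
    have hi : ∀ j, Integrable fun ω => |ν j| * |B ((⌊(n : ℝ) * s j⌋₊ : ℝ) / n) ω - B 0 ω| :=
      fun j => (hint j).abs.const_mul _
    calc _ ≤ ∫ ω, 3 / h ^ 2 * ∑ j, |ν j| * |B ((⌊(n : ℝ) * s j⌋₊ : ℝ) / n) ω - B 0 ω| := by
          refine integral_mono_of_nonneg (ae_of_all _ fun ω => abs_nonneg _)
            ((integrable_finsetSum _ fun j _ => hi j).const_mul _) (ae_of_all _ fun ω => ?_)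
          simp only
          rw [abs_mul, abs_of_pos (by positivity : 0 < 3 / h ^ 2)]
          gcongr
          refine (Finset.abs_sum_le_sum_abs _ _).trans (Finset.sum_le_sum fun j _ => ?_)
          rw [abs_mul]
      _ = 3 / h ^ 2 * ∑ j, |ν j| * ∫ ω, |B ((⌊(n : ℝ) * s j⌋₊ : ℝ) / n) ω - B 0 ω| := by
          rw [integral_const_mul, integral_finsetSum _ fun j _ => hi j]
          simp only [integral_const_mul]
      _ ≤ _ := by
          gcongr with j _
          refine (hB.integral_abs_sub_zero_le (hMs j).1).trans ?_
          gcongr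
          exact (hMs j).2
  have hsq1 : 2 * (V / h ^ 3 * (Λ / h)) ^ 2 * N * S ≤ 2 * (V * Λ) ^ 2 * T * S * (1 / h ^ 2) := by
    calc _ ≤ 2 * (V / h ^ 3 * (Λ / h)) ^ 2 * (h ^ 6 * T) * S := by gcongr
      _ = _ := by field_simp
  have hI0 : 0 ≤ ∫ x, (1 + x ^ 2) ^ 4 ∂gaussianReal 0 1 :=
    integral_nonneg fun x => by positivity
  have hsq2 : 108 * (∫ x, (1 + x ^ 2) ^ 4 ∂gaussianReal 0 1) * (V / h ^ 3) ^ 4 * N * S ^ 3 ≤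
      108 * (∫ x, (1 + x ^ 2) ^ 4 ∂gaussianReal 0 1) * V ^ 4 * T * S ^ 3 * (1 / h ^ 6) := by
    calc _ ≤ 108 * (∫ x, (1 + x ^ 2) ^ 4 ∂gaussianReal 0 1) * (V / h ^ 3) ^ 4 * (h ^ 6 * T) *
          S ^ 3 := by gcongr
      _ = _ := by field_simp
  refine (norm_sub_le_norm_sub_add_norm_sub _ _ _).trans
    (add_le_add (herr2.trans hbound) (main.trans ?_))
  gcongr

lemma tendsto_charFun (hB : IsFBM16 B) [IsProbabilityMeasure (volume : Measure Ω)]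
    {ι ι' : Type*} [Fintype ι] [Fintype ι'] {t : ι → ℝ} (ht : ∀ i, 0 ≤ t i) (c : ι → ℝ)
    {s : ι' → ℝ} (hs : ∀ j, 0 ≤ s j) (ν : ι' → ℝ) {κ2 : ℝ}
    (hκ2 : κ2 = (3 / 4) * ∑' r : ℤ, kappaTerm r) :
    Tendsto (fun n : ℕ => ∫ ω, Complex.exp ((∑ i, c i * B (t i) ω +
        ∑ j, ν j * ∑ k ∈ Finset.Icc 1 ⌊(n : ℝ) * s j⌋₊,
          (B ((k : ℝ) / n) ω - B (((k : ℝ) - 1) / n) ω) ^ 3 : ℝ) * Complex.I)) atTop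
      (𝓝 (Complex.exp (-((κ2 * ∑ i, ∑ j, ν i * ν j * min (s i) (s j) : ℝ) : ℂ) / 2) *
        ∫ ω, Complex.exp ((∑ i, c i * B (t i) ω : ℝ) * Complex.I))) := by
  set σ : ℕ → ℝ := fun n => 6 * ∑ i, ∑ j, ν i * ν j * ((1 / (n : ℝ)) *
      ∑ k ∈ Finset.range ⌊(n : ℝ) * s i⌋₊, ∑ l ∈ Finset.range ⌊(n : ℝ) * s j⌋₊,
        incrementCorr ((k : ℤ) - l) ^ 3) with hσ
  have hσlim : Tendsto σ atTop (𝓝 (κ2 * ∑ i, ∑ j, ν i * ν j * min (s i) (s j))) := by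
    have e : κ2 * ∑ i, ∑ j, ν i * ν j * min (s i) (s j) =
        6 * ∑ i, ∑ j, ν i * ν j * (min (s i) (s j) * ∑' r, incrementCorr r ^ 3) := by
      rw [hκ2]
      simp only [kappaTerm_eq, tsum_mul_left, Finset.mul_sum]
      refine Finset.sum_congr rfl fun i _ => Finset.sum_congr rfl fun j _ => ?_
      ring
    rw [e]
    exact (tendsto_finsetSum _ fun i _ => tendsto_finsetSum _ fun j _ =>
      (tendsto_toeplitz_sum summable_abs_incrementCorr_pow_three (hs i) (hs j)).const_mul _).const_mul _
  set h : ℕ → ℝ := fun n => (n : ℝ) ^ ((1 : ℝ) / 6) with hh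
  have hlim : Tendsto h atTop atTop :=
    (tendsto_rpow_atTop (by norm_num)).comp tendsto_natCast_atTop_atTop
  have hl : ∀ p : ℕ, p ≠ 0 → ∀ C : ℝ, Tendsto (fun n => C * (1 / h n ^ p)) atTop (𝓝 0) := by
    intro p hp C
    have := ((tendsto_pow_atTop hp).comp hlim).inv_tendsto_atTop.const_mul C
    simpa [Function.comp_def] using this
  have hbd : Tendsto (fun n => 3 / h n ^ 2 * ∑ j, |ν j| * (1 + s j ^ ((1 : ℝ) / 3)) +
      Real.exp |σ n| * (√(2 * ((∑ j, |ν j|) * ∑ i, |c i|) ^ 2 * (∑ j, s j) *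
        (∑' r, |incrementCorr r|) * (1 / h n ^ 2)) +
      √(108 * (∫ x, (1 + x ^ 2) ^ 4 ∂gaussianReal 0 1) * (∑ j, |ν j|) ^ 4 * (∑ j, s j) *
        (∑' r, |incrementCorr r|) ^ 3 * (1 / h n ^ 6)))) atTop (𝓝 0) := by
    have h1 := (hl 2 (by norm_num) 3).mul_const (∑ j, |ν j| * (1 + s j ^ ((1 : ℝ) / 3)))
    have h2 := (Real.continuous_exp.tendsto _).comp hσlim.abs
    have h3 := h1.add (h2.mul ((hl 2 (by norm_num) (2 * ((∑ j, |ν j|) * ∑ i, |c i|) ^ 2 *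
      (∑ j, s j) * (∑' r, |incrementCorr r|))).sqrt.add (hl 6 (by norm_num)
      (108 * (∫ x, (1 + x ^ 2) ^ 4 ∂gaussianReal 0 1) * (∑ j, |ν j|) ^ 4 * (∑ j, s j) *
        (∑' r, |incrementCorr r|) ^ 3)).sqrt))
    simpa [Function.comp_def, div_eq_mul_inv] using h3
  have hmain : Tendsto (fun n => Complex.exp (-(σ n : ℂ) / 2) *
      ∫ ω, Complex.exp ((∑ i, c i * B (t i) ω : ℝ) * Complex.I)) atTop
      (𝓝 (Complex.exp (-((κ2 * ∑ i, ∑ j, ν i * ν j * min (s i) (s j) : ℝ) : ℂ) / 2) *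
        ∫ ω, Complex.exp ((∑ i, c i * B (t i) ω : ℝ) * Complex.I))) := by
    refine Tendsto.mul_const _ ((Complex.continuous_exp.tendsto _).comp ?_)
    exact (((Complex.continuous_ofReal.tendsto _).comp hσlim).neg).div_const 2
  have hz := squeeze_zero_norm' ((eventually_gt_atTop 0).mono fun n hn =>
    hB.norm_charFun_sub_le ht c hs ν hn (h := h n) (σ2 := σ n) rfl rfl) hbd
  simpa using hz.add hmain

end IsFBM16

/-- The distance to the nearest integer: the primitive of the Haar function on each unit
interval, up to a factor. -/
def tent (x : ℝ) : ℝ := min (Int.fract x) (1 - Int.fract x)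

/-- The covariance kernel of independent Brownian bridges on the intervals `[k, k + 1]`. -/
def bridgeKernel (x y : ℝ) : ℝ :=
  if ⌊x⌋ = ⌊y⌋ then min (Int.fract x) (Int.fract y) - Int.fract x * Int.fract y else 0

lemma tent_nonneg (x : ℝ) : 0 ≤ tent x :=
  le_min (Int.fract_nonneg x) (sub_nonneg.2 (Int.fract_lt_one x).le)

lemma tent_le_one (x : ℝ) : tent x ≤ 1 :=
  (min_le_left _ _).trans (Int.fract_lt_one x).le

lemma tent_zero : tent 0 = 0 := by simp [tent]

lemma tent_le_abs (x : ℝ) : tent x ≤ |x| := by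
  rcases le_or_gt 0 x with hx | hx
  · refine (min_le_left _ _).trans ?_
    have : (0 : ℝ) ≤ ⌊x⌋ := by exact_mod_cast Int.floor_nonneg.2 hx
    rw [abs_of_nonneg hx, Int.fract]; linarith
  · refine (min_le_right _ _).trans ?_
    have h : ⌊x⌋ ≤ -1 := by
      have := Int.floor_lt.2 (by simpa using hx : x < ((0 : ℤ) : ℝ))
      omega
    have : (⌊x⌋ : ℝ) ≤ -1 := by exact_mod_cast h
    rw [abs_of_neg hx, Int.fract]; linarith

lemma continuous_tent_mul_floor (z : ℤ → ℝ) : Continuous fun x : ℝ => tent x * z ⌊x⌋ := by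
  have hfin : LocallyFinite fun k : ℤ => Set.Icc (k : ℝ) (k + 1) := by
    intro x
    refine ⟨Set.Ioo (x - 1) (x + 1), Ioo_mem_nhds (by linarith) (by linarith),
      (Set.finite_Icc (⌊x⌋ - 3) (⌊x⌋ + 3)).subset ?_⟩
    rintro k ⟨y, ⟨hy1, hy2⟩, hy3, hy4⟩
    have h1 := Int.floor_le x
    have h2 := Int.lt_floor_add_one x
    constructor
    · have : (⌊x⌋ : ℝ) - 3 < k := by linarith
      exact (by exact_mod_cast this : ⌊x⌋ - 3 < k).le
    · have : (k : ℝ) < ⌊x⌋ + 3 := by linarith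
      exact (by exact_mod_cast this : k < ⌊x⌋ + 3).le
  refine hfin.continuous ?_ (fun k => isClosed_Icc) fun k => ?_
  · exact Set.eq_univ_of_forall fun x => Set.mem_iUnion.2
      ⟨⌊x⌋, Int.floor_le x, (Int.lt_floor_add_one x).le⟩
  · refine ContinuousOn.congr (f := fun x : ℝ => min (x - k) (k + 1 - x) * z k) (by fun_prop) ?_
    rintro x ⟨hx1, hx2⟩
    rcases hx2.lt_or_eq with hx2 | rfl
    · have hk : ⌊x⌋ = k := Int.floor_eq_iff.2 ⟨hx1, hx2⟩
      simp only [tent, Int.fract, hk]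
      ring_nf
    · have : Int.fract ((k : ℝ) + 1) = 0 := by
        rw [Int.fract_add_one, Int.fract_intCast]
      simp [tent, this]

lemma floor_two_mul_of_fract_lt {x : ℝ} (h : Int.fract x < 1 / 2) :
    ⌊2 * x⌋ = 2 * ⌊x⌋ := by
  rw [Int.floor_eq_iff]
  have := Int.fract_nonneg x
  rw [Int.fract] at this h
  push_cast
  constructor <;> linarith

lemma floor_two_mul_of_le_fract {x : ℝ} (h : 1 / 2 ≤ Int.fract x) :
    ⌊2 * x⌋ = 2 * ⌊x⌋ + 1 := by
  rw [Int.floor_eq_iff]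
  have := Int.fract_lt_one x
  rw [Int.fract] at this h
  push_cast
  constructor <;> linarith

lemma fract_two_mul_of_fract_lt {x : ℝ} (h : Int.fract x < 1 / 2) :
    Int.fract (2 * x) = 2 * Int.fract x := by
  rw [Int.fract, floor_two_mul_of_fract_lt h, Int.fract]; push_cast; ring

lemma fract_two_mul_of_le_fract {x : ℝ} (h : 1 / 2 ≤ Int.fract x) :
    Int.fract (2 * x) = 2 * Int.fract x - 1 := by
  rw [Int.fract, floor_two_mul_of_le_fract h, Int.fract]; push_cast; ring

lemma tent_of_fract_lt {x : ℝ} (h : Int.fract x < 1 / 2) : tent x = Int.fract x :=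
  min_eq_left (by linarith)

lemma tent_of_le_fract {x : ℝ} (h : 1 / 2 ≤ Int.fract x) : tent x = 1 - Int.fract x :=
  min_eq_right (by linarith)

lemma bridgeKernel_eq (x y : ℝ) :
    bridgeKernel x y = (if ⌊x⌋ = ⌊y⌋ then tent x * tent y else 0) +
      bridgeKernel (2 * x) (2 * y) / 2 := by
  by_cases hxy : ⌊x⌋ = ⌊y⌋
  · have hmin : ∀ a b : ℝ, min (2 * a) (2 * b) = 2 * min a b := fun a b =>
      (mul_min_of_nonneg a b (by norm_num)).symm
    unfold bridgeKernel
    rw [if_pos hxy, if_pos hxy]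
    rcases lt_or_ge (Int.fract x) (1 / 2) with hx | hx <;>
      rcases lt_or_ge (Int.fract y) (1 / 2) with hy | hy
    · rw [floor_two_mul_of_fract_lt hx, floor_two_mul_of_fract_lt hy, if_pos (by rw [hxy]),
        fract_two_mul_of_fract_lt hx, fract_two_mul_of_fract_lt hy, tent_of_fract_lt hx,
        tent_of_fract_lt hy, hmin]
      ring
    · rw [floor_two_mul_of_fract_lt hx, floor_two_mul_of_le_fract hy, if_neg (by omega),
        tent_of_fract_lt hx, tent_of_le_fract hy, min_eq_left (by linarith)]
      ring
    · rw [floor_two_mul_of_le_fract hx, floor_two_mul_of_fract_lt hy, if_neg (by omega),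
        tent_of_le_fract hx, tent_of_fract_lt hy, min_eq_right (by linarith)]
      ring
    · rw [floor_two_mul_of_le_fract hx, floor_two_mul_of_le_fract hy, if_pos (by rw [hxy]),
        fract_two_mul_of_le_fract hx, fract_two_mul_of_le_fract hy, tent_of_le_fract hx,
        tent_of_le_fract hy, min_sub_sub_right, hmin]
      ring
  · have h2 : ⌊2 * x⌋ ≠ ⌊2 * y⌋ := by
      intro h
      have hx := Int.natCast_mul_floor_div_cancel (n := 2) (by norm_num) x
      have hy := Int.natCast_mul_floor_div_cancel (n := 2) (by norm_num) y
      push_cast at hx hy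
      exact hxy (by rw [← hx, ← hy, h])
    simp [bridgeKernel, hxy, h2]

lemma abs_bridgeKernel_le_one (x y : ℝ) : |bridgeKernel x y| ≤ 1 := by
  unfold bridgeKernel
  split_ifs
  · have hx := Int.fract_nonneg x
    have hx1 := (Int.fract_lt_one x).le
    have hy := Int.fract_nonneg y
    have hy1 := (Int.fract_lt_one y).le
    rw [abs_le]
    constructor
    · nlinarith [le_min hx hy]
    · nlinarith [min_le_left (Int.fract x) (Int.fract y), mul_nonneg hx hy]
  · simp

lemma sum_Ico_neg_eq_sum_range (f : ℤ → ℝ) (N : ℕ) :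
    ∑ n ∈ Finset.Ico (-(N : ℤ)) N, f n = ∑ n ∈ Finset.range N, (f n + f (-(n + 1))) := by
  induction N with
  | zero => simp
  | succ N ih =>
    have : Finset.Ico (-((N + 1 : ℕ) : ℤ)) ((N + 1 : ℕ) : ℤ) =
        insert (N : ℤ) (insert (-((N : ℤ) + 1)) (Finset.Ico (-(N : ℤ)) N)) := by
      ext k; simp only [Finset.mem_Ico, Finset.mem_insert]; push_cast; omega
    rw [this, Finset.sum_insert (by simp; omega), Finset.sum_insert (by simp), ih,
      Finset.sum_range_succ]
    ring

lemma tendsto_sum_Ico_neg {f : ℤ → ℝ} (hf : Summable f) :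
    Tendsto (fun N : ℕ => ∑ n ∈ Finset.Ico (-(N : ℤ)) N, f n) atTop (𝓝 (∑' n, f n)) := by
  simp only [sum_Ico_neg_eq_sum_range]
  exact hf.hasSum.nat_add_neg_add_one.tendsto_sum_nat

lemma sum_Ico_tent_mul_tent (s t : ℝ) (N : ℕ) :
    ∑ n ∈ Finset.Ico (-(N : ℤ)) N, (2 : ℝ) ^ (-n) *
        (if ⌊(2 : ℝ) ^ n * s⌋ = ⌊(2 : ℝ) ^ n * t⌋ then
          tent ((2 : ℝ) ^ n * s) * tent ((2 : ℝ) ^ n * t) else 0) =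
      2 ^ N * bridgeKernel (s / 2 ^ N) (t / 2 ^ N) - bridgeKernel (2 ^ N * s) (2 ^ N * t) / 2 ^ N := by
  have step : ∀ n : ℤ, (2 : ℝ) ^ (-n) *
        (if ⌊(2 : ℝ) ^ n * s⌋ = ⌊(2 : ℝ) ^ n * t⌋ then
          tent ((2 : ℝ) ^ n * s) * tent ((2 : ℝ) ^ n * t) else 0) =
      (2 : ℝ) ^ (-n) * bridgeKernel ((2 : ℝ) ^ n * s) ((2 : ℝ) ^ n * t) -
      (2 : ℝ) ^ (-(n + 1)) * bridgeKernel ((2 : ℝ) ^ (n + 1) * s) ((2 : ℝ) ^ (n + 1) * t) := by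
    intro n
    have e1 : (2 : ℝ) ^ (n + 1) = 2 * 2 ^ n := by
      rw [zpow_add_one₀ (by norm_num), mul_comm]
    have e2 : (2 : ℝ) ^ (-(n + 1)) = 2 ^ (-n) / 2 := by
      rw [zpow_neg, zpow_neg, e1, mul_inv]; ring
    rw [e2, e1, mul_assoc, mul_assoc, bridgeKernel_eq ((2 : ℝ) ^ n * s)]
    ring
  rw [sum_Ico_neg_eq_sum_range]
  induction N with
  | zero => simp
  | succ N ih =>
    rw [Finset.sum_range_succ, ih, step, step]
    have e : -(-((N : ℤ) + 1) + 1) = N := by ring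
    have e' : -((N : ℤ) + 1) + 1 = -N := by ring
    rw [e, e', neg_neg]
    have e3 : (2 : ℝ) ^ (-((N : ℤ) + 1)) = (2 ^ (N + 1))⁻¹ := by
      rw [zpow_neg]; norm_cast
    have e4 : (2 : ℝ) ^ ((N : ℤ) + 1) = 2 ^ (N + 1) := by norm_cast
    rw [e3, e4, zpow_neg, zpow_natCast]
    simp only [div_eq_inv_mul]
    ring

lemma tendsto_sum_Ico_tent_mul_tent {s t : ℝ} (hs : 0 ≤ s) (ht : 0 ≤ t) :
    Tendsto (fun N : ℕ => ∑ n ∈ Finset.Ico (-(N : ℤ)) N, (2 : ℝ) ^ (-n) *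
        (if ⌊(2 : ℝ) ^ n * s⌋ = ⌊(2 : ℝ) ^ n * t⌋ then
          tent ((2 : ℝ) ^ n * s) * tent ((2 : ℝ) ^ n * t) else 0)) atTop (𝓝 (min s t)) := by
  simp only [sum_Ico_tent_mul_tent]
  have hpow : Tendsto (fun N : ℕ => (2 : ℝ) ^ N) atTop atTop :=
    tendsto_pow_atTop_atTop_of_one_lt (by norm_num)
  have hdiv : ∀ c : ℝ, Tendsto (fun N : ℕ => c / (2 : ℝ) ^ N) atTop (𝓝 0) := fun c =>
    hpow.const_div_atTop c
  have h2 : Tendsto (fun N : ℕ => bridgeKernel (2 ^ N * s) (2 ^ N * t) / 2 ^ N) atTop (𝓝 0) := by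
    refine squeeze_zero_norm (fun N => ?_) (hdiv 1)
    rw [Real.norm_eq_abs, abs_div, abs_of_pos (by positivity : (0 : ℝ) < 2 ^ N)]
    gcongr
    exact abs_bridgeKernel_le_one _ _
  have h1 : Tendsto (fun N : ℕ => (2 : ℝ) ^ N * bridgeKernel (s / 2 ^ N) (t / 2 ^ N)) atTop
      (𝓝 (min s t)) := by
    have h3 : Tendsto (fun N : ℕ => min s t - s * t / 2 ^ N) atTop (𝓝 (min s t - 0)) :=
      tendsto_const_nhds.sub (hdiv _)
    rw [sub_zero] at h3
    refine h3.congr' ?_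
    filter_upwards [(hdiv s).eventually_lt_const one_pos, (hdiv t).eventually_lt_const one_pos]
      with N hsN htN
    have hs0 : 0 ≤ s / 2 ^ N := by positivity
    have ht0 : 0 ≤ t / 2 ^ N := by positivity
    rw [bridgeKernel, Int.floor_eq_zero_iff.2 ⟨hs0, hsN⟩, Int.floor_eq_zero_iff.2 ⟨ht0, htN⟩,
      if_pos rfl, Int.fract_eq_self.2 ⟨hs0, hsN⟩, Int.fract_eq_self.2 ⟨ht0, htN⟩,
      min_div_div_right (by positivity : (0 : ℝ) ≤ 2 ^ N)]
    field_simp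
  simpa using h1.sub h2

section GaussianLimit

variable {Ω : Type*} [MeasurableSpace Ω] {P : Measure Ω}

lemma integral_sq_of_map_eq_gaussianReal {Y : Ω → ℝ} (hY : Measurable Y) {v : NNReal}
    (h : P.map Y = gaussianReal 0 v) : ∫ ω, Y ω ^ 2 ∂P = v := by
  have h1 := integral_map hY.aemeasurable (f := fun x : ℝ => x ^ 2) (μ := P) (by fun_prop)
  rw [← h1, h]
  have h2 : variance id (gaussianReal 0 v) = v := variance_id_gaussianReal
  rw [variance_eq_integral aemeasurable_id] at h2
  simpa only [id, integral_id_gaussianReal, sub_zero] using h2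

lemma charFun_map_eq_integral {Y : Ω → ℝ} (hY : Measurable Y) (θ : ℝ) :
    charFun (P.map Y) θ = ∫ ω, Complex.exp ((θ * Y ω : ℝ) * Complex.I) ∂P := by
  rw [charFun_apply_real, integral_map hY.aemeasurable (by fun_prop)]
  simp

lemma map_eq_gaussianReal_of_tendsto [IsProbabilityMeasure P] {Y : ℕ → Ω → ℝ} {Z : Ω → ℝ}
    (hY : ∀ N, Measurable (Y N)) (hZ : Measurable Z) {v : ℕ → NNReal} {w : NNReal}
    (h : ∀ N, P.map (Y N) = gaussianReal 0 (v N)) (hv : Tendsto v atTop (𝓝 w))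
    (hYZ : ∀ᵐ ω ∂P, Tendsto (fun N => Y N ω) atTop (𝓝 (Z ω))) :
    P.map Z = gaussianReal 0 w := by
  have := Measure.isProbabilityMeasure_map (μ := P) hZ.aemeasurable
  refine Measure.ext_of_charFun (funext fun θ => ?_)
  have h1 : Tendsto (fun N => charFun (P.map (Y N)) θ) atTop (𝓝 (charFun (P.map Z) θ)) := by
    rw [charFun_map_eq_integral hZ]
    simp only [charFun_map_eq_integral (hY _)]
    refine tendsto_integral_of_dominated_convergence (fun _ => 1)
      (fun N => by have := hY N; fun_prop) (integrable_const 1)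
      (fun N => ae_of_all _ fun ω => by rw [Complex.norm_exp_ofReal_mul_I]) ?_
    filter_upwards [hYZ] with ω hω
    exact ((by fun_prop : Continuous fun x : ℝ =>
      Complex.exp ((θ * x : ℝ) * Complex.I)).tendsto _).comp hω
  refine tendsto_nhds_unique h1 ?_
  simp only [h, charFun_gaussianReal]
  have h2 : Tendsto (fun N => ((v N : ℝ) : ℂ)) atTop (𝓝 ((w : ℝ) : ℂ)) :=
    (Complex.continuous_ofReal.tendsto _).comp ((NNReal.continuous_coe.tendsto _).comp hv)
  exact (Complex.continuous_exp.tendsto _).comp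
    (tendsto_const_nhds.sub ((h2.mul_const _).div_const _))

end GaussianLimit

/-- The law of a family of independent standard Gaussian variables indexed by `ℤ × ℤ`. -/
def whiteNoise : Measure (ℤ × ℤ → ℝ) := Measure.infinitePi fun _ => gaussianReal 0 1

instance : IsProbabilityMeasure whiteNoise :=
  inferInstanceAs (IsProbabilityMeasure (Measure.infinitePi fun _ => gaussianReal 0 1))

lemma whiteNoise_map_eval (p : ℤ × ℤ) : whiteNoise.map (fun z => z p) = gaussianReal 0 1 :=
  Measure.infinitePi_map_eval (fun _ => gaussianReal 0 1) p

lemma iIndepFun_whiteNoise : iIndepFun (fun (p : ℤ × ℤ) (z : ℤ × ℤ → ℝ) => z p) whiteNoise :=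
  iIndepFun_infinitePi (P := fun _ : ℤ × ℤ => gaussianReal 0 1) (X := fun _ x => x)
    fun _ => measurable_id

lemma integral_whiteNoise_eval (p : ℤ × ℤ) : ∫ z, z p ∂whiteNoise = 0 := by
  have h := integral_map (measurable_pi_apply p).aemeasurable (f := fun x : ℝ => x)
    (μ := whiteNoise) (by fun_prop)
  rw [whiteNoise_map_eval, integral_id_gaussianReal] at h
  exact h.symm

lemma integral_whiteNoise_eval_mul (p q : ℤ × ℤ) :
    ∫ z, z p * z q ∂whiteNoise = if p = q then 1 else 0 := by
  split_ifs with h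
  · subst h
    have := integral_sq_of_map_eq_gaussianReal (measurable_pi_apply p) (whiteNoise_map_eval p)
    simpa [sq] using this
  · rw [(iIndepFun_whiteNoise.indepFun h).integral_fun_mul_eq_mul_integral
      (measurable_pi_apply p).aestronglyMeasurable (measurable_pi_apply q).aestronglyMeasurable,
      integral_whiteNoise_eval, zero_mul]

lemma map_eq_gaussianReal_of_mem_span_eval {Y : (ℤ × ℤ → ℝ) → ℝ}
    (hY : Y ∈ Submodule.span ℝ (Set.range fun (p : ℤ × ℤ) (z : ℤ × ℤ → ℝ) => z p)) :
    Measurable Y ∧ MemLp Y 2 whiteNoise ∧ ∃ v : NNReal, whiteNoise.map Y = gaussianReal 0 v := by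
  obtain ⟨c, rfl⟩ := Finsupp.mem_span_range_iff_exists_finsupp.1 hY
  have e : (c.sum fun i a => a • fun z : ℤ × ℤ → ℝ => z i) =
      fun z => ∑ p : c.support, c p * z p := by
    ext z
    simp only [Finsupp.sum, Finset.sum_apply, Pi.smul_apply, smul_eq_mul]
    exact (Finset.sum_coe_sort c.support fun p => c p * z p).symm
  rw [e]
  have hm : Measurable fun z : ℤ × ℤ → ℝ => ∑ p : c.support, c p * z p := by fun_prop
  have hlaw : ∀ p, HasGaussianLaw (fun z : ℤ × ℤ → ℝ => z p) whiteNoise := fun p =>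
    ⟨by rw [whiteNoise_map_eval]; infer_instance⟩
  have hind : iIndepFun (fun (p : c.support) (z : ℤ × ℤ → ℝ) => c p * z p) whiteNoise :=
    (iIndepFun_whiteNoise.precomp Subtype.val_injective).comp
      (fun (p : c.support) (x : ℝ) => c p * x) fun p => measurable_const_mul _
  have hG : HasGaussianLaw (fun z : ℤ × ℤ → ℝ => ∑ p : c.support, c p * z p) whiteNoise :=
    hind.hasGaussianLaw_fun_sum fun p => (hlaw p).fun_smul (c p)
  refine ⟨hm, hG.memLp_two, ?_⟩
  have := hG.isGaussian_map
  have h0 : ∫ z, ∑ p : c.support, c p * z p ∂whiteNoise = 0 := by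
    rw [integral_finsetSum _ fun (p : c.support) _ => (hlaw p).integrable.const_mul (c p)]
    simp [integral_const_mul, integral_whiteNoise_eval]
  have h1 := IsGaussian.eq_gaussianReal (whiteNoise.map
    fun z : ℤ × ℤ → ℝ => ∑ p : c.support, c p * z p)
  rw [integral_map hm.aemeasurable (by fun_prop)] at h1
  simp only [id, h0] at h1
  exact ⟨_, h1 this⟩

/-- The `n`-th level of the Lévy construction of Brownian motion, with coefficients `z`. -/
def levyTerm (t : ℝ) (z : ℤ × ℤ → ℝ) (n : ℤ) : ℝ :=
  √2 ^ (-n) * (tent (2 ^ n * t) * z (n, ⌊(2 : ℝ) ^ n * t⌋))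

lemma continuous_levyTerm (z : ℤ × ℤ → ℝ) (n : ℤ) : Continuous fun t => levyTerm t z n :=
  ((continuous_tent_mul_floor fun k => z (n, k)).comp (continuous_const_mul ((2 : ℝ) ^ n))).const_mul _

lemma measurable_levyTerm (t : ℝ) (n : ℤ) : Measurable fun z => levyTerm t z n := by
  unfold levyTerm
  fun_prop

lemma levyTerm_zero (z : ℤ × ℤ → ℝ) (n : ℤ) : levyTerm 0 z n = 0 := by
  simp [levyTerm, tent_zero]

/-- Summable weights controlling the growth of the coefficients. -/
def levyWeight (p : ℤ × ℤ) : ℝ := (1 / 2) ^ p.1.natAbs * (1 / (1 + |(p.2 : ℝ)|) ^ 2)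

lemma levyWeight_pos (p : ℤ × ℤ) : 0 < levyWeight p := by
  unfold levyWeight
  positivity

lemma summable_pow_natAbs {q : ℝ} (h0 : 0 ≤ q) (h1 : q < 1) :
    Summable fun n : ℤ => q ^ n.natAbs := by
  refine summable_int_iff_summable_nat_and_neg.2 ⟨?_, ?_⟩ <;>
    simpa using summable_geometric_of_lt_one h0 h1

lemma summable_levyWeight : Summable levyWeight := by
  have h1 : Summable fun n : ℤ => ((1 : ℝ) / 2) ^ n.natAbs :=
    summable_pow_natAbs (by norm_num) (by norm_num)
  have h2 : Summable fun k : ℤ => 1 / (1 + |(k : ℝ)|) ^ 2 := by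
    have h3 : Summable fun k : ℕ => 1 / (1 + (k : ℝ)) ^ 2 := by
      have := (summable_nat_add_iff 1).2 (Real.summable_one_div_nat_pow.2 one_lt_two)
      simpa [add_comm] using this
    refine summable_int_iff_summable_nat_and_neg.2 ⟨?_, ?_⟩ <;> simpa using h3
  exact h1.mul_of_nonneg h2 (fun _ => by positivity) fun _ => by positivity

lemma levyTerm_pow_le {z : ℤ × ℤ → ℝ} {S T : ℝ} (hz : ∀ p, levyWeight p * z p ^ 8 ≤ S)
    {t : ℝ} (ht : |t| ≤ T) (n : ℤ) :
    levyTerm t z n ^ 8 ≤ S * (T + 2) ^ 10 * (1 / 2) ^ n.natAbs := by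
  have hT : 0 ≤ T := (abs_nonneg t).trans ht
  have hS : 0 ≤ S := le_trans (mul_nonneg (levyWeight_pos (0, 0)).le (by positivity)) (hz (0, 0))
  set a : ℝ := 2 ^ n with ha
  have ha0 : 0 < a := by positivity
  have hr : (√2 ^ (-n)) ^ 8 = (a⁻¹) ^ 4 := by
    have h2 : (√2 ^ n) ^ 2 = a := by
      rw [← zpow_natCast, ← zpow_mul, mul_comm, zpow_mul]
      simp [ha]
    rw [zpow_neg, ← h2]
    ring
  set k : ℤ := ⌊a * t⌋ with hk
  have hk1 : 1 + |(k : ℝ)| ≤ 2 + a * T := by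
    have h1 := Int.floor_le (a * t)
    have h2 := Int.lt_floor_add_one (a * t)
    have h3 : |a * t| ≤ a * T := by
      rw [abs_mul, abs_of_pos ha0]
      gcongr
    have h4 := abs_le.1 h3
    have : |(k : ℝ)| ≤ 1 + a * T := abs_le.2 ⟨by rw [hk]; linarith, by rw [hk]; linarith⟩
    linarith
  have hw := hz (n, k)
  simp only [levyWeight] at hw
  have htent := tent_nonneg (a * t)
  have hz8 : 0 ≤ z (n, k) ^ 8 := by positivity
  have hexp : levyTerm t z n ^ 8 = (a⁻¹) ^ 4 * (tent (a * t) ^ 8 * z (n, k) ^ 8) := by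
    rw [levyTerm, mul_pow, mul_pow, hr]
  rw [hexp]
  set h : ℝ := (1 / 2) ^ n.natAbs with hh
  have hh0 : 0 < h := by positivity
  have hz' : z (n, k) ^ 8 ≤ S * (1 + |(k : ℝ)|) ^ 2 * h⁻¹ := by
    have hb : 0 < (1 + |(k : ℝ)|) ^ 2 := by positivity
    have := mul_le_mul_of_nonneg_right hw (mul_pos hb (inv_pos.2 hh0)).le
    calc z (n, k) ^ 8 = h * (1 / (1 + |(k : ℝ)|) ^ 2) * z (n, k) ^ 8 *
          ((1 + |(k : ℝ)|) ^ 2 * h⁻¹) := by field_simp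
      _ ≤ _ := this
      _ = _ := by ring
  rcases le_total 0 n with hn | hn
  · have hha : h = a⁻¹ := by
      rw [hh, ha]
      lift n to ℕ using hn
      simp
    have ha1 : 1 ≤ a := one_le_zpow₀ one_le_two hn
    have ht8 : tent (a * t) ^ 8 ≤ 1 := pow_le_one₀ htent (tent_le_one _)
    have hk2 : 1 + |(k : ℝ)| ≤ a * (T + 2) := by nlinarith
    calc (a⁻¹) ^ 4 * (tent (a * t) ^ 8 * z (n, k) ^ 8)
        ≤ (a⁻¹) ^ 4 * (1 * (S * (a * (T + 2)) ^ 2 * h⁻¹)) := by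
          gcongr
          refine hz'.trans ?_
          gcongr
      _ = S * (T + 2) ^ 2 * h := by
          rw [hha]
          field_simp
      _ ≤ _ := by
          have := pow_le_pow_right₀ (by linarith : 1 ≤ T + 2) (by norm_num : 2 ≤ 10)
          gcongr
  · have hha : h = a := by
      rw [hh, ha]
      obtain ⟨m, rfl⟩ := Int.exists_eq_neg_ofNat hn
      simp
    have ha1 : a ≤ 1 := zpow_le_one_of_nonpos₀ one_le_two hn
    have ht8 : tent (a * t) ≤ a * (T + 2) := by
      refine (tent_le_abs _).trans ?_
      rw [abs_mul, abs_of_pos ha0]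
      gcongr
      linarith
    have hk2 : 1 + |(k : ℝ)| ≤ T + 2 := by nlinarith
    calc (a⁻¹) ^ 4 * (tent (a * t) ^ 8 * z (n, k) ^ 8)
        ≤ (a⁻¹) ^ 4 * ((a * (T + 2)) ^ 8 * (S * (T + 2) ^ 2 * h⁻¹)) := by
          gcongr
          refine hz'.trans ?_
          gcongr
      _ = S * (T + 2) ^ 10 * (a * a ^ 2) := by
          rw [hha]
          field_simp
      _ ≤ S * (T + 2) ^ 10 * (a * 1) := by
          gcongr
          exact pow_le_one₀ ha0.le ha1
      _ = _ := by rw [hha, mul_one]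

lemma exists_abs_levyTerm_le {z : ℤ × ℤ → ℝ} {S : ℝ} (hz : ∀ p, levyWeight p * z p ^ 8 ≤ S)
    (T : ℝ) : ∃ u : ℤ → ℝ, Summable u ∧ ∀ t, |t| ≤ T → ∀ n, |levyTerm t z n| ≤ u n := by
  have hS : 0 ≤ S := le_trans (mul_nonneg (levyWeight_pos (0, 0)).le (by positivity)) (hz (0, 0))
  set M : ℝ := (S * (T + 2) ^ 10) ^ ((8 : ℕ) : ℝ)⁻¹ with hM
  set q : ℝ := (1 / 2) ^ ((8 : ℕ) : ℝ)⁻¹ with hq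
  have hM8 : M ^ 8 = S * (T + 2) ^ 10 := Real.rpow_inv_natCast_pow (by positivity) (by norm_num)
  have hq8 : q ^ 8 = 1 / 2 := Real.rpow_inv_natCast_pow (by positivity) (by norm_num)
  have hM0 : 0 ≤ M := by positivity
  have hq0 : 0 ≤ q := by positivity
  have hq1 : q < 1 := Real.rpow_lt_one (by norm_num) (by norm_num) (by norm_num)
  refine ⟨fun n => M * q ^ n.natAbs, (summable_pow_natAbs hq0 hq1).mul_left M,
    fun t ht n => ?_⟩
  refine (pow_le_pow_iff_left₀ (abs_nonneg _) (by positivity) (n := 8) (by norm_num)).1 ?_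
  rw [mul_pow, hM8, ← pow_mul, mul_comm n.natAbs, pow_mul, hq8, Even.pow_abs (by decide)]
  exact levyTerm_pow_le hz ht n

/-- The full-measure set of coefficients on which the Lévy series converges locally uniformly. -/
def levyGoodSet : Set (ℤ × ℤ → ℝ) :=
  {z | ∑' p, ENNReal.ofReal (levyWeight p * z p ^ 8) ≠ ⊤}

lemma measurableSet_levyGoodSet : MeasurableSet levyGoodSet := by
  have : Measurable fun z : ℤ × ℤ → ℝ => ∑' p, ENNReal.ofReal (levyWeight p * z p ^ 8) :=
    Measurable.tsum fun p => by fun_prop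
  exact (this (measurableSet_singleton ⊤)).compl

lemma exists_le_of_mem_levyGoodSet {z : ℤ × ℤ → ℝ} (hz : z ∈ levyGoodSet) :
    ∃ S, ∀ p, levyWeight p * z p ^ 8 ≤ S := by
  refine ⟨(∑' p, ENNReal.ofReal (levyWeight p * z p ^ 8)).toReal, fun p => ?_⟩
  exact (ENNReal.ofReal_le_iff_le_toReal hz).1 (ENNReal.le_tsum p)

lemma ae_mem_levyGoodSet : ∀ᵐ z ∂whiteNoise, z ∈ levyGoodSet := by
  have hm : ∀ p : ℤ × ℤ, Measurable fun z : ℤ × ℤ → ℝ =>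
      ENNReal.ofReal (levyWeight p * z p ^ 8) := fun p => by fun_prop
  have hC : ∫⁻ x, ENNReal.ofReal (x ^ 8) ∂gaussianReal 0 1 ≠ ⊤ := by
    have h8 := (memLp_id_gaussianReal' (μ := 0) (v := 1) 8 (by norm_num)).integrable_norm_pow
      (by norm_num)
    refine (lt_of_le_of_lt (lintegral_mono fun x => ?_) h8.2).ne
    simp [Real.enorm_eq_ofReal_abs, ← ENNReal.ofReal_pow, Even.pow_abs (by decide : Even 8)]
  have hint : ∫⁻ z, ∑' p, ENNReal.ofReal (levyWeight p * z p ^ 8) ∂whiteNoise ≠ ⊤ := by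
    rw [lintegral_tsum fun p => (hm p).aemeasurable]
    have : ∀ p : ℤ × ℤ, ∫⁻ z, ENNReal.ofReal (levyWeight p * z p ^ 8) ∂whiteNoise =
        ENNReal.ofReal (levyWeight p) * ∫⁻ x, ENNReal.ofReal (x ^ 8) ∂gaussianReal 0 1 := by
      intro p
      rw [← whiteNoise_map_eval p, lintegral_map (by fun_prop) (measurable_pi_apply p),
        ← lintegral_const_mul _ (by fun_prop)]
      simp only [ENNReal.ofReal_mul (levyWeight_pos p).le]
    simp only [this]
    rw [ENNReal.tsum_mul_right]
    exact ENNReal.mul_ne_top summable_levyWeight.tsum_ofReal_ne_top hC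
  filter_upwards [ae_lt_top (Measurable.tsum hm) hint] with z hz
  exact hz.ne

/-- Brownian motion, as the sum of the Lévy series. -/
def levyBM (t : ℝ) (z : ℤ × ℤ → ℝ) : ℝ :=
  levyGoodSet.indicator (fun z => ∑' n, levyTerm t z n) z

lemma levyBM_zero (z : ℤ × ℤ → ℝ) : levyBM 0 z = 0 := by
  simp [levyBM, levyTerm_zero]

lemma continuous_levyBM (z : ℤ × ℤ → ℝ) : Continuous fun t => levyBM t z := by
  by_cases hz : z ∈ levyGoodSet
  · simp only [levyBM, Set.indicator_of_mem hz]
    obtain ⟨S, hS⟩ := exists_le_of_mem_levyGoodSet hz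
    refine continuous_iff_continuousAt.2 fun t₀ => ?_
    obtain ⟨u, hu, hle⟩ := exists_abs_levyTerm_le hS (|t₀| + 1)
    have hc : ContinuousOn (fun t => ∑' n, levyTerm t z n) {t | |t| < |t₀| + 1} :=
      continuousOn_tsum (fun n => (continuous_levyTerm z n).continuousOn) hu
        fun n t ht => hle t (le_of_lt ht) n
    refine hc.continuousAt (IsOpen.mem_nhds ?_ (by simp))
    exact isOpen_lt continuous_abs continuous_const
  · simp only [levyBM, Set.indicator_of_notMem hz]
    exact continuous_const

/-- The partial sums of the Lévy series. -/
def levySum (t : ℝ) (N : ℕ) (z : ℤ × ℤ → ℝ) : ℝ :=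
  ∑ n ∈ Finset.Ico (-(N : ℤ)) N, levyTerm t z n

lemma measurable_levySum (t : ℝ) (N : ℕ) : Measurable (levySum t N) :=
  Finset.measurable_fun_sum _ fun n _ => measurable_levyTerm t n

lemma tendsto_levySum {z : ℤ × ℤ → ℝ} (hz : z ∈ levyGoodSet) (t : ℝ) :
    Tendsto (fun N => levySum t N z) atTop (𝓝 (levyBM t z)) := by
  obtain ⟨S, hS⟩ := exists_le_of_mem_levyGoodSet hz
  obtain ⟨u, hu, hle⟩ := exists_abs_levyTerm_le hS |t|
  simp only [levyBM, Set.indicator_of_mem hz]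
  exact tendsto_sum_Ico_neg (hu.of_norm_bounded fun n => hle t le_rfl n)

lemma measurable_levyBM (t : ℝ) : Measurable (levyBM t) := by
  refine measurable_of_tendsto_metrizable
    (f := fun N => levyGoodSet.indicator (levySum t N)) (fun N =>
      (measurable_levySum t N).indicator measurableSet_levyGoodSet) ?_
  refine tendsto_pi_nhds.2 fun z => ?_
  by_cases hz : z ∈ levyGoodSet
  · simpa [hz] using tendsto_levySum hz t
  · simp [levyBM, hz]

lemma integrable_sq_of_map_eq_gaussianReal {Ω : Type*} [MeasurableSpace Ω] {P : Measure Ω}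
    {Y : Ω → ℝ} (hY : Measurable Y) {v : NNReal} (h : P.map Y = gaussianReal 0 v) :
    Integrable (fun ω => Y ω ^ 2) P := by
  have h2 : MemLp id 2 (P.map Y) := h ▸ memLp_id_gaussianReal' 2 (by norm_num)
  exact (h2.comp_of_map hY.aemeasurable).integrable_sq

lemma levyTerm_mem_span (t : ℝ) (n : ℤ) : (fun z => levyTerm t z n) ∈
    Submodule.span ℝ (Set.range fun (p : ℤ × ℤ) (z : ℤ × ℤ → ℝ) => z p) := by
  have : (fun z => levyTerm t z n) = (√2 ^ (-n) * tent (2 ^ n * t)) •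
      fun z : ℤ × ℤ → ℝ => z (n, ⌊(2 : ℝ) ^ n * t⌋) := by
    ext z
    simp [levyTerm, mul_assoc]
  rw [this]
  exact Submodule.smul_mem _ _ (Submodule.subset_span ⟨_, rfl⟩)

lemma levySum_mem_span (t : ℝ) (N : ℕ) : levySum t N ∈
    Submodule.span ℝ (Set.range fun (p : ℤ × ℤ) (z : ℤ × ℤ → ℝ) => z p) := by
  have : levySum t N = ∑ n ∈ Finset.Ico (-(N : ℤ)) N, fun z => levyTerm t z n := by
    ext z
    simp [levySum]
  rw [this]
  exact Submodule.sum_mem _ fun n _ => levyTerm_mem_span t n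

lemma memLp_levyTerm (t : ℝ) (n : ℤ) : MemLp (fun z => levyTerm t z n) 2 whiteNoise :=
  (map_eq_gaussianReal_of_mem_span_eval (levyTerm_mem_span t n)).2.1

lemma memLp_levySum (t : ℝ) (N : ℕ) : MemLp (levySum t N) 2 whiteNoise :=
  (map_eq_gaussianReal_of_mem_span_eval (levySum_mem_span t N)).2.1

lemma integral_levyTerm_mul (s t : ℝ) (m n : ℤ) :
    ∫ z, levyTerm s z m * levyTerm t z n ∂whiteNoise = if m = n then
      (2 : ℝ) ^ (-n) * (if ⌊(2 : ℝ) ^ n * s⌋ = ⌊(2 : ℝ) ^ n * t⌋ then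
        tent (2 ^ n * s) * tent (2 ^ n * t) else 0) else 0 := by
  have h1 : ∀ z, levyTerm s z m * levyTerm t z n =
      √2 ^ (-m) * tent (2 ^ m * s) * (√2 ^ (-n) * tent (2 ^ n * t)) *
        (z (m, ⌊(2 : ℝ) ^ m * s⌋) * z (n, ⌊(2 : ℝ) ^ n * t⌋)) := fun z => by
    simp only [levyTerm]
    ring
  simp only [h1]
  rw [integral_const_mul, integral_whiteNoise_eval_mul]
  by_cases hmn : m = n
  · subst hmn
    have h2 : √2 ^ (-m) * √2 ^ (-m) = (2 : ℝ) ^ (-m) := by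
      rw [← mul_zpow]
      simp
    simp only [Prod.mk.injEq, true_and, if_true]
    split_ifs
    · rw [← h2]
      ring
    · simp
  · simp [hmn]

lemma integral_levySum_mul (s t : ℝ) (N : ℕ) :
    ∫ z, levySum s N z * levySum t N z ∂whiteNoise = ∑ n ∈ Finset.Ico (-(N : ℤ)) N,
      (2 : ℝ) ^ (-n) * (if ⌊(2 : ℝ) ^ n * s⌋ = ⌊(2 : ℝ) ^ n * t⌋ then
        tent (2 ^ n * s) * tent (2 ^ n * t) else 0) := by
  simp only [levySum, Finset.sum_mul_sum]
  have hi : ∀ m n, Integrable (fun z => levyTerm s z m * levyTerm t z n) whiteNoise :=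
    fun m n => (memLp_levyTerm s m).integrable_mul (memLp_levyTerm t n)
  rw [integral_finsetSum _ fun m _ => integrable_finsetSum _ fun n _ => hi m n]
  refine Finset.sum_congr rfl fun m hm => ?_
  rw [integral_finsetSum _ fun n _ => hi m n]
  simp only [integral_levyTerm_mul]
  rw [Finset.sum_ite_eq, if_pos hm]

lemma sum_mul_sq_eq {ι : Type*} [Fintype ι] (c x : ι → ℝ) :
    (∑ i, c i * x i) ^ 2 = ∑ i, ∑ j, c i * c j * (x i * x j) := by
  rw [sq, Finset.sum_mul_sum]
  exact Finset.sum_congr rfl fun i _ => Finset.sum_congr rfl fun j _ => by ring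

lemma map_sum_levyBM {ι : Type*} [Fintype ι] {t : ι → ℝ} (ht : ∀ i, 0 ≤ t i) (c : ι → ℝ) :
    ∃ v : NNReal, (v : ℝ) = ∑ i, ∑ j, c i * c j * min (t i) (t j) ∧
      whiteNoise.map (fun z => ∑ i, c i * levyBM (t i) z) = gaussianReal 0 v := by
  have hspan : ∀ N : ℕ, (fun z => ∑ i, c i * levySum (t i) N z) ∈
      Submodule.span ℝ (Set.range fun (p : ℤ × ℤ) (z : ℤ × ℤ → ℝ) => z p) := by
    intro N
    have : (fun z => ∑ i, c i * levySum (t i) N z) = ∑ i, c i • levySum (t i) N := by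
      ext z
      simp
    rw [this]
    exact Submodule.sum_mem _ fun i _ => Submodule.smul_mem _ _ (levySum_mem_span _ N)
  choose hm _ v hv using fun N => map_eq_gaussianReal_of_mem_span_eval (hspan N)
  have hvar : ∀ N : ℕ, (v N : ℝ) = ∑ i, ∑ j, c i * c j *
      ∫ z, levySum (t i) N z * levySum (t j) N z ∂whiteNoise := by
    intro N
    have hi : ∀ i j, Integrable (fun z => c i * c j * (levySum (t i) N z * levySum (t j) N z))
        whiteNoise := fun i j =>
      ((memLp_levySum (t i) N).integrable_mul (memLp_levySum (t j) N)).const_mul _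
    rw [← integral_sq_of_map_eq_gaussianReal (hm N) (hv N)]
    simp only [sum_mul_sq_eq]
    rw [integral_finsetSum _ fun i _ => integrable_finsetSum _ fun j _ => hi i j]
    refine Finset.sum_congr rfl fun i _ => ?_
    rw [integral_finsetSum _ fun j _ => hi i j]
    exact Finset.sum_congr rfl fun j _ => integral_const_mul _ _
  have hlim : Tendsto (fun N => (v N : ℝ)) atTop
      (𝓝 (∑ i, ∑ j, c i * c j * min (t i) (t j))) := by
    simp only [hvar, integral_levySum_mul]
    exact tendsto_finsetSum _ fun i _ => tendsto_finsetSum _ fun j _ =>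
      (tendsto_sum_Ico_tent_mul_tent (ht i) (ht j)).const_mul _
  have h0 : 0 ≤ ∑ i, ∑ j, c i * c j * min (t i) (t j) :=
    ge_of_tendsto' hlim fun N => NNReal.coe_nonneg _
  refine ⟨⟨_, h0⟩, rfl, ?_⟩
  refine map_eq_gaussianReal_of_tendsto hm
    (Finset.measurable_fun_sum _ fun i _ => (measurable_levyBM _).const_mul _) hv
    (NNReal.tendsto_coe.1 hlim) ?_
  filter_upwards [ae_mem_levyGoodSet] with z hz
  exact tendsto_finsetSum _ fun i _ => (tendsto_levySum hz _).const_mul _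

lemma integral_levyBM_mul {s t : ℝ} (hs : 0 ≤ s) (ht : 0 ≤ t) :
    ∫ z, levyBM s z * levyBM t z ∂whiteNoise = min s t := by
  have hst : ∀ i, 0 ≤ (![s, t] : Fin 2 → ℝ) i := by
    intro i
    fin_cases i <;> simpa
  have hmeas : ∀ c : Fin 2 → ℝ, Measurable fun z => ∑ i, c i * levyBM (![s, t] i) z :=
    fun c => Finset.measurable_fun_sum _ fun i _ => (measurable_levyBM _).const_mul _
  obtain ⟨v, hv, hv'⟩ := map_sum_levyBM hst ![1, 1]
  obtain ⟨w, hw, hw'⟩ := map_sum_levyBM hst ![1, -1]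
  have h1 := integral_sq_of_map_eq_gaussianReal (hmeas _) hv'
  have h2 := integral_sq_of_map_eq_gaussianReal (hmeas _) hw'
  have i1 := integrable_sq_of_map_eq_gaussianReal (hmeas _) hv'
  have i2 := integrable_sq_of_map_eq_gaussianReal (hmeas _) hw'
  have h3 := integral_sub i1 i2
  rw [h1, h2, hv, hw] at h3
  simp only [Fin.sum_univ_two, Matrix.cons_val_zero, Matrix.cons_val_one] at h3
  have h4 : ∀ z, levyBM s z * levyBM t z = 1 / 4 *
      ((1 * levyBM s z + 1 * levyBM t z) ^ 2 - (1 * levyBM s z + -1 * levyBM t z) ^ 2) :=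
    fun z => by ring
  simp only [h4]
  rw [integral_const_mul, h3, min_comm t s]
  ring

lemma IsFBM16.of_map_eq {Ω Ω' : Type*} [MeasureSpace Ω] [MeasureSpace Ω'] {B : ℝ → Ω → ℝ}
    {B' : ℝ → Ω' → ℝ} (hB : IsFBM16 B) (hm : ∀ t, Measurable (B' t))
    (hc : ∀ ω, Continuous fun t => B' t ω)
    (h : (volume : Measure Ω').map (fun ω t => B' t ω) =
      (volume : Measure Ω).map (fun ω t => B t ω)) : IsFBM16 B' := by
  have hmB : Measurable fun ω t => B t ω := measurable_pi_lambda _ hB.1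
  have hmB' : Measurable fun ω t => B' t ω := measurable_pi_lambda _ hm
  refine ⟨hm, hc, fun m t c ht => ?_, fun s t hs ht => ?_⟩
  · obtain ⟨v, hv⟩ := hB.2.2.1 m t c ht
    refine ⟨v, ?_⟩
    have hg : Measurable fun f : ℝ → ℝ => ∑ i, c i * f (t i) := by fun_prop
    rw [← hv]
    have := congrArg (Measure.map fun f : ℝ → ℝ => ∑ i, c i * f (t i)) h
    rwa [Measure.map_map hg hmB, Measure.map_map hg hmB'] at this
  · rw [← hB.2.2.2 s t hs ht]
    have hg : Measurable fun f : ℝ → ℝ => f s * f t := by fun_prop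
    have h1 := integral_map hmB.aemeasurable (μ := volume) hg.aestronglyMeasurable
    have h2 := integral_map hmB'.aemeasurable (μ := volume) hg.aestronglyMeasurable
    rw [← h1, ← h2, h]

lemma tendsto_integral_boundedContinuous_of_tendsto_integral_exp {Ω Ω' ι ι' : Type*}
    [MeasurableSpace Ω] [MeasurableSpace Ω'] {P : Measure Ω} {Q : Measure Ω'}
    [IsProbabilityMeasure P] [IsProbabilityMeasure Q] [Fintype ι] [Fintype ι']
    {X : ℕ → Ω → ι → ℝ} {Y : ℕ → Ω → ι' → ℝ} {X₀ : Ω' → ι → ℝ} {Y₀ : Ω' → ι' → ℝ}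
    (hX : ∀ n, Measurable (X n)) (hY : ∀ n, Measurable (Y n))
    (hX₀ : Measurable X₀) (hY₀ : Measurable Y₀)
    (h : ∀ (c : ι → ℝ) (ν : ι' → ℝ), Tendsto (fun n =>
      ∫ ω, Complex.exp ((∑ i, c i * X n ω i + ∑ j, ν j * Y n ω j : ℝ) * Complex.I) ∂P) atTop
      (𝓝 (∫ ω, Complex.exp ((∑ i, c i * X₀ ω i + ∑ j, ν j * Y₀ ω j : ℝ) * Complex.I) ∂Q)))
    (F : BoundedContinuousFunction ((ι → ℝ) × (ι' → ℝ)) ℝ) :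
    Tendsto (fun n => ∫ ω, F (X n ω, Y n ω) ∂P) atTop (𝓝 (∫ ω, F (X₀ ω, Y₀ ω) ∂Q)) := by
  let J : (ι → ℝ) × (ι' → ℝ) → EuclideanSpace ℝ (ι ⊕ ι') := fun x => WithLp.toLp 2 (Sum.elim x.1 x.2)
  let G : EuclideanSpace ℝ (ι ⊕ ι') → (ι → ℝ) × (ι' → ℝ) := fun x => (fun i => x (Sum.inl i), fun j => x (Sum.inr j))
  have hG : Continuous G := by fun_prop
  have hJ : Measurable J := by
    refine (WithLp.measurable_toLp 2 _).comp (measurable_pi_lambda _ fun k => ?_)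
    rcases k with i | j
    · exact (measurable_pi_apply i).comp measurable_fst
    · exact (measurable_pi_apply j).comp measurable_snd
  have hGJ : ∀ x, G (J x) = x := fun x => rfl
  have hZ : ∀ n, Measurable fun ω => J (X n ω, Y n ω) := fun n =>
    hJ.comp ((hX n).prodMk (hY n))
  have hZ₀ : Measurable fun ω => J (X₀ ω, Y₀ ω) := hJ.comp (hX₀.prodMk hY₀)
  let μ : ℕ → ProbabilityMeasure (EuclideanSpace ℝ (ι ⊕ ι')) := fun n =>
    ⟨P.map fun ω => J (X n ω, Y n ω), Measure.isProbabilityMeasure_map (hZ n).aemeasurable⟩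
  let μ₀ : ProbabilityMeasure (EuclideanSpace ℝ (ι ⊕ ι')) :=
    ⟨Q.map fun ω => J (X₀ ω, Y₀ ω), Measure.isProbabilityMeasure_map hZ₀.aemeasurable⟩
  have hinner : ∀ (x : (ι → ℝ) × (ι' → ℝ)) (ξ : EuclideanSpace ℝ (ι ⊕ ι')), inner ℝ (J x) ξ =
      ∑ i, ξ (Sum.inl i) * x.1 i + ∑ j, ξ (Sum.inr j) * x.2 j := by
    intro x ξ
    simp [J, PiLp.inner_apply, Fintype.sum_sum_type]
  have hlim : Tendsto μ atTop (𝓝 μ₀) := by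
    refine ProbabilityMeasure.tendsto_of_tendsto_charFun fun ξ => ?_
    have h1 := h (fun i => ξ (Sum.inl i)) fun j => ξ (Sum.inr j)
    have e : ∀ n, charFun (μ n : Measure (EuclideanSpace ℝ (ι ⊕ ι'))) ξ = ∫ ω, Complex.exp
        ((∑ i, ξ (Sum.inl i) * X n ω i + ∑ j, ξ (Sum.inr j) * Y n ω j : ℝ) * Complex.I) ∂P := by
      intro n
      rw [charFun_apply]
      refine (integral_map (hZ n).aemeasurable (by fun_prop)).trans ?_
      simp only [hinner]
    have e₀ : charFun (μ₀ : Measure (EuclideanSpace ℝ (ι ⊕ ι'))) ξ = ∫ ω, Complex.exp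
        ((∑ i, ξ (Sum.inl i) * X₀ ω i + ∑ j, ξ (Sum.inr j) * Y₀ ω j : ℝ) * Complex.I) ∂Q := by
      rw [charFun_apply]
      refine (integral_map hZ₀.aemeasurable (by fun_prop)).trans ?_
      simp only [hinner]
    simpa only [e, e₀] using h1
  have h2 := ProbabilityMeasure.tendsto_iff_forall_integral_tendsto.1 hlim
    (F.compContinuous ⟨G, hG⟩)
  have hF : Measurable fun x => F (G x) := (F.continuous.comp hG).measurable
  have e : ∀ n, ∫ x, F.compContinuous ⟨G, hG⟩ x ∂(μ n : Measure (EuclideanSpace ℝ (ι ⊕ ι'))) =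
      ∫ ω, F (X n ω, Y n ω) ∂P := fun n =>
    integral_map (hZ n).aemeasurable hF.aestronglyMeasurable
  have e₀ : ∫ x, F.compContinuous ⟨G, hG⟩ x ∂(μ₀ : Measure (EuclideanSpace ℝ (ι ⊕ ι'))) = ∫ ω, F (X₀ ω, Y₀ ω) ∂Q :=
    integral_map hZ₀.aemeasurable hF.aestronglyMeasurable
  simpa only [e, e₀] using h2

/-- Fractional Brownian motion paths, together with the coefficients of an independent Lévy
series. -/
abbrev PathNoise : Type := {f : ℝ → ℝ // Continuous f} × (ℤ × ℤ → ℝ)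

/-- The law on path space of a continuous process. -/
def pathLaw {Ω : Type*} [MeasurableSpace Ω] (P : Measure Ω) {B : ℝ → Ω → ℝ}
    (hc : ∀ ω, Continuous fun t => B t ω) : Measure {f : ℝ → ℝ // Continuous f} :=
  P.map fun ω => ⟨fun t => B t ω, hc ω⟩

section PathNoise

variable {Ω : Type*} [MeasurableSpace Ω] {P : Measure Ω}
  {B : ℝ → Ω → ℝ} {hc : ∀ ω, Continuous fun t => B t ω}

lemma measurable_toPath (hm : ∀ t, Measurable (B t)) :
    Measurable fun ω => (⟨fun t => B t ω, hc ω⟩ : {f : ℝ → ℝ // Continuous f}) :=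
  (measurable_pi_lambda _ hm).subtype_mk

lemma map_val_pathLaw (hm : ∀ t, Measurable (B t)) :
    (pathLaw P hc).map Subtype.val = P.map fun ω t => B t ω :=
  Measure.map_map measurable_subtype_coe (measurable_toPath hm)

lemma measurable_path_eval (u : ℝ) : Measurable fun ω : PathNoise => ω.1.1 u :=
  (measurable_pi_apply u).comp (measurable_subtype_coe.comp measurable_fst)

lemma measurable_noise_levyBM (u : ℝ) : Measurable fun ω : PathNoise => levyBM u ω.2 :=
  (measurable_levyBM u).comp measurable_snd

variable [IsProbabilityMeasure P]

lemma isProbabilityMeasure_pathLaw (hm : ∀ t, Measurable (B t)) :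
    IsProbabilityMeasure (pathLaw P hc) :=
  Measure.isProbabilityMeasure_map (measurable_toPath hm).aemeasurable

lemma map_path_prod (hm : ∀ t, Measurable (B t)) :
    ((pathLaw P hc).prod whiteNoise).map (fun ω u => ω.1.1 u) = P.map fun ω t => B t ω := by
  have := isProbabilityMeasure_pathLaw (P := P) (hc := hc) hm
  rw [← map_val_pathLaw (hc := hc) hm]
  have h1 : ((pathLaw P hc).prod whiteNoise).map Prod.fst = pathLaw P hc := by simp
  conv_rhs => rw [← h1]
  rw [Measure.map_map measurable_subtype_coe measurable_fst]
  rfl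

lemma integral_comp_snd_prod (hm : ∀ t, Measurable (B t)) (g : (ℤ × ℤ → ℝ) → ℝ) :
    ∫ ω, g ω.2 ∂((pathLaw P hc).prod whiteNoise) = ∫ z, g z ∂whiteNoise := by
  have := isProbabilityMeasure_pathLaw (P := P) (hc := hc) hm
  simp [integral_fun_snd]

lemma indep_path_noise (hm : ∀ t, Measurable (B t)) :
    Indep (⨆ u : ℝ, MeasurableSpace.comap (fun ω : PathNoise => ω.1.1 u) inferInstance)
      (⨆ u : ℝ, MeasurableSpace.comap (fun ω : PathNoise => levyBM u ω.2) inferInstance)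
      ((pathLaw P hc).prod whiteNoise) := by
  have := isProbabilityMeasure_pathLaw (P := P) (hc := hc) hm
  have h := indepFun_prod (μ := pathLaw P hc) (ν := whiteNoise) measurable_id measurable_id
  rw [IndepFun_iff_Indep] at h
  refine indep_of_indep_of_le_left (indep_of_indep_of_le_right h (iSup_le fun u => ?_))
    (iSup_le fun u => ?_)
  · rw [← measurable_iff_comap_le]
    exact (measurable_levyBM u).comp (comap_measurable _)
  · rw [← measurable_iff_comap_le]
    exact ((measurable_pi_apply u).comp measurable_subtype_coe).comp (comap_measurable _)

lemma integral_exp_path_add_noise (hm : ∀ t, Measurable (B t)) {ι ι' : Type*} [Fintype ι]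
    [Fintype ι'] (t : ι → ℝ) (c : ι → ℝ) {s : ι' → ℝ} (hs : ∀ j, 0 ≤ s j) (ν : ι' → ℝ) (κ : ℝ) :
    ∫ ω, Complex.exp ((∑ i, c i * ω.1.1 (t i) + ∑ j, ν j * (κ * levyBM (s j) ω.2) : ℝ) *
        Complex.I) ∂((pathLaw P hc).prod whiteNoise) =
      Complex.exp (-((κ ^ 2 * ∑ i, ∑ j, ν i * ν j * min (s i) (s j) : ℝ) : ℂ) / 2) *
        ∫ ω, Complex.exp ((∑ i, c i * B (t i) ω : ℝ) * Complex.I) ∂P := by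
  have := isProbabilityMeasure_pathLaw (P := P) (hc := hc) hm
  have h1 : ∀ ω : PathNoise,
      Complex.exp ((∑ i, c i * ω.1.1 (t i) + ∑ j, ν j * (κ * levyBM (s j) ω.2) : ℝ) *
        Complex.I) = Complex.exp ((∑ i, c i * ω.1.1 (t i) : ℝ) * Complex.I) *
        Complex.exp ((∑ j, ν j * κ * levyBM (s j) ω.2 : ℝ) * Complex.I) := by
    intro ω
    rw [← Complex.exp_add, ← add_mul, ← Complex.ofReal_add]
    simp only [mul_assoc]
  simp only [h1]
  rw [integral_prod_mul (μ := pathLaw P hc) (ν := whiteNoise)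
    (fun f : {f : ℝ → ℝ // Continuous f} =>
      Complex.exp ((∑ i, c i * f.1 (t i) : ℝ) * Complex.I))
    fun z => Complex.exp ((∑ j, ν j * κ * levyBM (s j) z : ℝ) * Complex.I), mul_comm]
  congr 1
  · obtain ⟨v, hv, hv'⟩ := map_sum_levyBM hs fun j => ν j * κ
    have h2 := charFun_map_eq_integral (P := whiteNoise) (Finset.measurable_fun_sum Finset.univ
      fun j _ => (measurable_levyBM (s j)).const_mul (ν j * κ)) 1
    rw [hv', charFun_gaussianReal] at h2
    simp only [one_mul] at h2
    rw [← h2]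
    congr 1
    have h3 : (v : ℝ) = κ ^ 2 * ∑ i, ∑ j, ν i * ν j * min (s i) (s j) := by
      rw [hv, Finset.mul_sum]
      refine Finset.sum_congr rfl fun i _ => ?_
      rw [Finset.mul_sum]
      exact Finset.sum_congr rfl fun j _ => by ring
    rw [← h3]
    simp
    ring
  · have hg : Measurable fun f : {f : ℝ → ℝ // Continuous f} =>
        Complex.exp ((∑ i, c i * f.1 (t i) : ℝ) * Complex.I) := by
      have : ∀ u : ℝ, Measurable fun f : {f : ℝ → ℝ // Continuous f} => f.1 u := fun u =>
        (measurable_pi_apply u).comp measurable_subtype_coe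
      have h4 : Measurable fun f : {f : ℝ → ℝ // Continuous f} => ∑ i, c i * f.1 (t i) :=
        Finset.measurable_fun_sum _ fun i _ => (this _).const_mul _
      exact Complex.measurable_exp.comp ((Complex.measurable_ofReal.comp h4).mul_const _)
    exact integral_map (measurable_toPath hm).aemeasurable hg.aestronglyMeasurable

end PathNoise

/-- The finite-dimensional distributions of `(B, V_n)`, where
`V_n(t) = ∑_{j=1}^{⌊nt⌋} (ΔB_{j,n})³`, converge to those of `(B, κ W)` for a standard
Brownian motion `W` independent of `B`: the signed cubic variation of `B` is `κ W`. -/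
theorem stmt9 {Ω : Type*} [MeasureSpace Ω] [IsProbabilityMeasure (volume : Measure Ω)]
    (B : ℝ → Ω → ℝ) (hB : IsFBM16 B)
    (κ : ℝ) (hκ : 0 < κ) (hκ2 : κ ^ 2 = (3 / 4) * ∑' r : ℤ, kappaTerm r)
    (d m : ℕ) (t : Fin d → ℝ) (s : Fin m → ℝ)
    (ht0 : ∀ i, 0 ≤ t i) (htmono : StrictMono t)
    (hs0 : ∀ j, 0 ≤ s j) (hsmono : StrictMono s) :
    ∃ (Ω' : Type) (_ : MeasureSpace Ω') (_ : IsProbabilityMeasure (volume : Measure Ω'))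
      (B' W : ℝ → Ω' → ℝ),
      IsFBM16 B' ∧ IsStdBM W ∧
      Indep (⨆ u : ℝ, MeasurableSpace.comap (B' u) inferInstance)
            (⨆ u : ℝ, MeasurableSpace.comap (W u) inferInstance)
            (volume : Measure Ω') ∧
      ∀ F : BoundedContinuousFunction ((Fin d → ℝ) × (Fin m → ℝ)) ℝ,
        Tendsto (fun n : ℕ =>
            ∫ ω, F (fun i => B (t i) ω,
                    fun j => ∑ k ∈ Finset.Icc 1 ⌊(n : ℝ) * s j⌋₊,
                      (B ((k : ℝ) / n) ω - B (((k : ℝ) - 1) / n) ω) ^ 3))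
          atTop
          (𝓝 (∫ ω', F (fun i => B' (t i) ω', fun j => κ * W (s j) ω'))) := by
  have hm := hB.1
  have hprob := isProbabilityMeasure_pathLaw (P := volume) (hc := hB.2.1) hm
  let Q : Measure PathNoise := (pathLaw volume hB.2.1).prod whiteNoise
  let _ : MeasureSpace PathNoise := ⟨Q⟩
  have hQ : IsProbabilityMeasure (volume : Measure PathNoise) :=
    inferInstanceAs (IsProbabilityMeasure Q)
  refine ⟨PathNoise, inferInstance, hQ, fun u ω => ω.1.1 u, fun u ω => levyBM u ω.2,
    hB.of_map_eq measurable_path_eval (fun ω => ω.1.2) (map_path_prod hm),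
    ⟨measurable_noise_levyBM, fun ω => continuous_levyBM ω.2, fun ω => levyBM_zero ω.2,
      fun k r c hr => ?_, fun u v hu hv => ?_⟩, indep_path_noise hm, fun F => ?_⟩
  · obtain ⟨v, -, hv⟩ := map_sum_levyBM hr c
    refine ⟨v, ?_⟩
    have h1 : Q.map Prod.snd = whiteNoise := by simp [Q]
    rw [← hv, ← h1, Measure.map_map (Finset.measurable_fun_sum _ fun i _ =>
      (measurable_levyBM _).const_mul _) measurable_snd]
    rfl
  · exact (integral_comp_snd_prod hm fun z => levyBM u z * levyBM v z).trans
      (integral_levyBM_mul hu hv)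
  · refine tendsto_integral_boundedContinuous_of_tendsto_integral_exp
      (P := (volume : Measure Ω)) (Q := Q)
      (X := fun _ ω i => B (t i) ω)
      (Y := fun n ω j => ∑ k ∈ Finset.Icc 1 ⌊(n : ℝ) * s j⌋₊,
        (B ((k : ℝ) / n) ω - B (((k : ℝ) - 1) / n) ω) ^ 3)
      (X₀ := fun ω i => ω.1.1 (t i)) (Y₀ := fun ω j => κ * levyBM (s j) ω.2)
      (fun _ => measurable_pi_lambda _ fun i => hm _)
      (fun n => measurable_pi_lambda _ fun j => Finset.measurable_fun_sum _ fun k _ =>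
        ((hm _).sub (hm _)).pow_const 3)
      (measurable_pi_lambda _ fun i => measurable_path_eval _)
      (measurable_pi_lambda _ fun j => (measurable_noise_levyBM _).const_mul κ)
      (fun c ν => ?_) F
    rw [integral_exp_path_add_noise hm t c hs0 ν κ]
    exact hB.tendsto_charFun ht0 c hs0 ν hκ2
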